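/- arXiv:2107.06043 — 5 statements merged into one kernel-verified Lean document; each statement's English description precedes it below -/
import Mathlib

section
/- Let Ω' ⊆ Ω ⊂ ℝⁿ be two bounded measurable sets with d := diam(Ω) ≤ 1, let 0 < σ < s < 1, let 1 ≤ q and 1 < p₋ ≤ p₊ < ∞ with q < p₋, and let p : Ω × Ω → ℝ be a measurable function with p(x,y) = p(y,x) and p₋ ≤ p(x,y) ≤ p₊ for all x, y ∈ Ω. Then there exists C = C(n, s, σ, p₊, p₋, q) > 0 such that for every measurable u : Ω → ℝ with [u]_{W^{s,p(·,·)}(Ω)} < ∞: (∫_Ω ∫_{Ω'} |u(x)−u(y)|^q |x−y|^{−n−σq} dy dx)^{1/q} ≤ C · max{ (|Ω'| · d^{(s−σ)·p₊q/(p₊−q)})^{(p₊−q)/(p₊q)}, (|Ω'| · d^{(s−σ)·p₊q/(p₊−q)})^{(p₋−q)/(p₋q)} } · [u]_{W^{s,p(·,·)}(Ω)}. -/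
open MeasureTheory Metric Set Filter
open scoped ENNReal Topology
noncomputable section

/-- `ℝⁿ` with the Euclidean norm and Lebesgue measure. -/
abbrev Rn (n : ℕ) := EuclideanSpace ℝ (Fin n)

/-- `p₊(E × F) = sup_{x ∈ E, y ∈ F} p(x,y)`. -/
def pSup {n : ℕ} (p : Rn n → Rn n → ℝ) (E F : Set (Rn n)) : ℝ :=
  sSup (Set.image2 p E F)

/-- `p₋(E × F) = inf_{x ∈ E, y ∈ F} p(x,y)`. -/
def pInf {n : ℕ} (p : Rn n → Rn n → ℝ) (E F : Set (Rn n)) : ℝ :=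
  sInf (Set.image2 p E F)

/-- Standing assumptions on the variable exponent: continuity, symmetry and
`1 < inf p ≤ sup p < ∞`. -/
def ExponentOK {n : ℕ} (p : Rn n → Rn n → ℝ) : Prop :=
  Continuous (fun z : Rn n × Rn n => p z.1 z.2) ∧ (∀ x y, p x y = p y x) ∧
    ∃ pm pM : ℝ, 1 < pm ∧ ∀ x y, pm ≤ p x y ∧ p x y ≤ pM

/-- Membership in the fractional Sobolev space `W^{s,p(·,·)}(ℝⁿ)`. -/
def MemW {n : ℕ} (s : ℝ) (p : Rn n → Rn n → ℝ) (u : Rn n → ℝ) : Prop :=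
  Measurable u ∧
    (∫⁻ x, ENNReal.ofReal (|u x| ^ p x x)) < ⊤ ∧
    (∫⁻ x, ∫⁻ y, ENNReal.ofReal (|u x - u y| ^ p x y / ‖x - y‖ ^ ((n : ℝ) + s * p x y))) < ⊤

/-- Weak subsolution of `(-Δ)^s_{p(·,·)} u = 0` in `Ω`. -/
def IsWeakSubsol {n : ℕ} (s : ℝ) (p : Rn n → Rn n → ℝ) (Ω : Set (Rn n)) (u : Rn n → ℝ) : Prop :=
  ∀ φ : Rn n → ℝ, MemW s p φ → (∀ x, 0 ≤ φ x) → (∀ᵐ x, x ∉ Ω → φ x = 0) →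
    (∫ x, ∫ y, |u x - u y| ^ (p x y - 2) * (u x - u y) * (φ x - φ y)
      / ‖x - y‖ ^ ((n : ℝ) + s * p x y)) ≤ 0

/-- Weak supersolution of `(-Δ)^s_{p(·,·)} u = 0` in `Ω`. -/
def IsWeakSupersol {n : ℕ} (s : ℝ) (p : Rn n → Rn n → ℝ) (Ω : Set (Rn n)) (u : Rn n → ℝ) : Prop :=
  ∀ φ : Rn n → ℝ, MemW s p φ → (∀ x, 0 ≤ φ x) → (∀ᵐ x, x ∉ Ω → φ x = 0) →
    0 ≤ (∫ x, ∫ y, |u x - u y| ^ (p x y - 2) * (u x - u y) * (φ x - φ y)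
      / ‖x - y‖ ^ ((n : ℝ) + s * p x y))

/-- Weak solution of `(-Δ)^s_{p(·,·)} u = 0` in `Ω`. -/
def IsWeakSol {n : ℕ} (s : ℝ) (p : Rn n → Rn n → ℝ) (Ω : Set (Rn n)) (u : Rn n → ℝ) : Prop :=
  IsWeakSubsol s p Ω u ∧ IsWeakSupersol s p Ω u

/-- Condition (P1) in `Ω` with constant `L`. -/
def CondP1 {n : ℕ} (p : Rn n → Rn n → ℝ) (Ω : Set (Rn n)) (L : ℝ) : Prop :=
  ∀ (x₀ : Rn n) (R : ℝ), 0 < R → closedBall x₀ R ⊆ Ω →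
    R ^ (pInf p (ball x₀ R) (ball x₀ R) - pSup p (ball x₀ R) (ball x₀ R)) ≤ L

/-- Condition (P2) in `Ω`. -/
def CondP2 {n : ℕ} (p : Rn n → Rn n → ℝ) (Ω : Set (Rn n)) : Prop :=
  ∀ (x₀ : Rn n) (R : ℝ), 0 < R → closedBall x₀ R ⊆ Ω →
    pSup p (ball x₀ R) ((ball x₀ R)ᶜ) ≤ pSup p (ball x₀ R) (ball x₀ R) ∧
    pInf p (ball x₀ R) ((ball x₀ R)ᶜ) ≤ pInf p (ball x₀ R) (ball x₀ R)

/-- The Gagliardo modular with variable exponent. -/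
def gagModular {n : ℕ} (s : ℝ) (p : Rn n → Rn n → ℝ) (Ω : Set (Rn n)) (u : Rn n → ℝ) : ℝ≥0∞ :=
  ∫⁻ x in Ω, ∫⁻ y in Ω, ENNReal.ofReal (|u x - u y| ^ p x y / ‖x - y‖ ^ ((n : ℝ) + s * p x y))

/-- The Luxemburg-type Gagliardo seminorm `[u]_{W^{s,p(·,·)}(Ω)}`. -/
def gagSeminorm {n : ℕ} (s : ℝ) (p : Rn n → Rn n → ℝ) (Ω : Set (Rn n)) (u : Rn n → ℝ) : ℝ :=
  sInf {lam : ℝ | 0 < lam ∧ gagModular s p Ω (fun x => u x / lam) ≤ 1}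

/-- The integral of `‖x‖ ^ (a - n)`, `a > 0`, over a ball of radius `d` in `ℝⁿ` is at most a
constant times `d ^ a`. -/
lemma exists_setLIntegral_closedBall_rpow_le {n : ℕ} (hn : 1 ≤ n) {a : ℝ} (ha : 0 < a) :
    ∃ C : ℝ, 0 ≤ C ∧ ∀ d : ℝ, 0 < d → ∀ y : Rn n,
      ∫⁻ x in closedBall y d, ENNReal.ofReal (‖x - y‖ ^ (a - n)) ≤ ENNReal.ofReal (C * d ^ a) := by
  have hfin : Module.finrank ℝ (Rn n) = n := by simp
  have hmeas : Measurable fun x : Rn n => ‖x‖ ^ (a - n) := by fun_prop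
  have hint (d : ℝ) : IntegrableOn (fun x : Rn n => ‖x‖ ^ (a - n)) (closedBall 0 d) := by
    refine (integrableOn_ball_of_norm_le_rpow (by omega) (α := n - a) (C := 1) (r := d + 1)
      (by rw [hfin]; linarith) (.of_forall fun x => ?_) hmeas.aestronglyMeasurable).mono_set
      (closedBall_subset_ball (by linarith))
    rw [Real.norm_of_nonneg (by positivity), one_mul, neg_sub]
  refine ⟨∫ x in closedBall (0 : Rn n) 1, ‖x‖ ^ (a - n),
    integral_nonneg fun x => by positivity, fun d hd y => ?_⟩
  have htrans : ∫⁻ x in closedBall y d, ENNReal.ofReal (‖x - y‖ ^ (a - n))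
      = ∫⁻ x in closedBall (0 : Rn n) d, ENNReal.ofReal (‖x‖ ^ (a - n)) := by
    rw [← lintegral_indicator measurableSet_closedBall,
      ← lintegral_indicator measurableSet_closedBall,
      ← lintegral_sub_right_eq_self
        ((closedBall (0 : Rn n) d).indicator fun x => ENNReal.ofReal (‖x‖ ^ (a - n))) y]
    congr 1
    ext x
    simp [indicator, dist_eq_norm]
  have hscale := Measure.setIntegral_comp_smul_of_pos (volume : Measure (Rn n))
    (fun x : Rn n => ‖x‖ ^ (a - n)) (closedBall 0 1) hd
  rw [hfin, _root_.smul_closedBall _ _ zero_le_one, smul_zero, Real.norm_of_nonneg hd.le, mul_one,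
    smul_eq_mul] at hscale
  simp_rw [norm_smul, Real.norm_of_nonneg hd.le, Real.mul_rpow hd.le (norm_nonneg _),
    integral_const_mul] at hscale
  rw [htrans, ← ofReal_integral_eq_lintegral_ofReal (hint d) (.of_forall fun x => by positivity)]
  refine ENNReal.ofReal_le_ofReal (le_of_eq ?_)
  rw [eq_inv_mul_iff_mul_eq₀ (by positivity)] at hscale
  rw [← hscale, ← mul_assoc, ← Real.rpow_natCast, ← Real.rpow_add hd, mul_comm]
  ring_nf

/-- A scaled Young inequality with exponents `p / q` and `p / (p - q)`. -/
lemma mul_rpow_le_of_rpow_le {F G M T p pM q : ℝ} (hF : 0 ≤ F) (hG : 0 < G) (hG1 : G ≤ 1)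
    (hM : 0 < M) (hT : 0 < T) (hq : 0 < q) (hqp : q < p) (hpM : p ≤ pM)
    (hTM : T ^ ((p - q) / (p * q)) ≤ M) :
    (F * G) ^ q ≤ M ^ q * F ^ p + M ^ q / T * G ^ (pM * q / (pM - q)) := by
  have hp : 0 < p := hq.trans hqp
  have hpq : 0 < p - q := sub_pos.2 hqp
  rcases le_or_gt ((F * G) ^ q) (M ^ q * F ^ p) with h | h
  · exact h.trans (le_add_of_nonneg_right (by positivity))
  have hF0 : 0 < F := by
    rcases hF.eq_or_lt with rfl | h0
    · simp [Real.zero_rpow hq.ne', Real.zero_rpow hp.ne'] at h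
    · exact h0
  have hle : F ≤ (G / M) ^ (q / (p - q)) := by
    rw [← Real.rpow_le_rpow_iff hF (by positivity) hpq, ← Real.rpow_mul (by positivity),
      div_mul_cancel₀ _ hpq.ne', Real.div_rpow hG.le hM.le, le_div_iff₀ (by positivity),
      ← mul_le_mul_iff_right₀ (Real.rpow_pos_of_pos hF0 q), Real.rpow_sub hF0]
    rw [Real.mul_rpow hF hG.le] at h
    refine le_trans (le_of_eq ?_) h.le
    field_simp
  have hTM' : T ≤ M ^ (p * q / (p - q)) := by
    have := Real.rpow_le_rpow (by positivity) hTM (show 0 ≤ p * q / (p - q) by positivity)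
    rwa [← Real.rpow_mul hT.le, show (p - q) / (p * q) * (p * q / (p - q)) = 1 by field_simp,
      Real.rpow_one] at this
  have hexp : pM * q / (pM - q) ≤ p * q / (p - q) := by
    rw [div_le_div_iff₀ (by linarith) hpq]
    nlinarith [mul_nonneg (mul_nonneg hq.le hq.le) (sub_nonneg.2 hpM)]
  calc (F * G) ^ q ≤ ((G / M) ^ (q / (p - q)) * G) ^ q := by gcongr
    _ = M ^ q / M ^ (p * q / (p - q)) * G ^ (p * q / (p - q)) := by
      have hG' : G = M * (G / M) := by field_simp
      have hGM : 0 < G / M := by positivity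
      generalize G / M = t at *
      subst hG'
      rw [mul_left_comm, ← Real.rpow_add_one hGM.ne', Real.mul_rpow hM.le (by positivity),
        ← Real.rpow_mul hGM.le, Real.mul_rpow hM.le hGM.le,
        show (q / (p - q) + 1) * q = p * q / (p - q) by field_simp; ring]
      field_simp
    _ ≤ M ^ q / T * G ^ (pM * q / (pM - q)) := by
      gcongr M ^ q / ?_ * ?_
      exact Real.rpow_le_rpow_of_exponent_ge hG hG1 hexp
    _ ≤ _ := le_add_of_nonneg_left (by positivity)

lemma rpow_le_max_of_mem_Icc {T a b e : ℝ} (hT : 0 < T) (hae : a ≤ e) (heb : e ≤ b) :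
    T ^ e ≤ max (T ^ b) (T ^ a) := by
  rcases le_total T 1 with h | h
  · exact le_max_of_le_right (Real.rpow_le_rpow_of_exponent_ge hT h hae)
  · exact le_max_of_le_left (Real.rpow_le_rpow_of_exponent_le h heb)

/-- Pointwise comparison of the Gagliardo kernels of orders `σ < s` and exponents `q < p`. -/
lemma gagliardo_kernel_le {n : ℕ} {a r s σ M T p pM q : ℝ} (ha : 0 ≤ a) (hr : 0 ≤ r) (hr1 : r ≤ 1)
    (har : r = 0 → a = 0) (hσs : σ < s) (hM : 0 < M) (hT : 0 < T) (hq : 0 < q) (hqp : q < p)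
    (hpM : p ≤ pM) (hTM : T ^ ((p - q) / (p * q)) ≤ M) :
    a ^ q / r ^ (n + σ * q) ≤ M ^ q * (a ^ p / r ^ (n + s * p))
      + M ^ q / T * r ^ ((s - σ) * (pM * q / (pM - q)) - n) := by
  rcases hr.eq_or_lt with rfl | hr0
  · rw [har rfl, Real.zero_rpow hq.ne', zero_div]
    positivity
  have key := mul_rpow_le_of_rpow_le (F := a / r ^ s) (G := r ^ (s - σ)) (by positivity)
    (by positivity) (Real.rpow_le_one hr hr1 (by linarith)) hM hT hq hqp hpM hTM
  have hFG : a / r ^ s * r ^ (s - σ) = a / r ^ σ := by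
    rw [Real.rpow_sub hr0]
    field_simp
  rw [hFG, Real.div_rpow ha (by positivity), Real.div_rpow ha (by positivity),
    ← Real.rpow_mul hr, ← Real.rpow_mul hr, ← Real.rpow_mul hr] at key
  have key' := div_le_div_of_nonneg_right key (show 0 ≤ r ^ (n : ℝ) by positivity)
  rw [Real.rpow_add hr0, Real.rpow_add hr0, Real.rpow_sub hr0]
  refine le_trans (le_of_eq ?_) (key'.trans (le_of_eq ?_))
  · field_simp
  · field_simp

lemma setLIntegral_setLIntegral_le_add {α β : Type*} [MeasurableSpace α] [MeasurableSpace β]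
    {μ : Measure α} {ν : Measure β} [SFinite ν] {s : Set α} {t : Set β} (hs : MeasurableSet s)
    (ht : MeasurableSet t) {a b : ℝ≥0∞} (ha : a ≠ ⊤) {f g h : α → β → ℝ≥0∞}
    (hh : Measurable (Function.uncurry h))
    (hfgh : ∀ x ∈ s, ∀ y ∈ t, f x y ≤ a * g x y + b * h x y) :
    ∫⁻ x in s, ∫⁻ y in t, f x y ∂ν ∂μ
      ≤ a * (∫⁻ x in s, ∫⁻ y in t, g x y ∂ν ∂μ) + b * ∫⁻ x in s, ∫⁻ y in t, h x y ∂ν ∂μ := by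
  have hh_int : Measurable fun x => ∫⁻ y in t, h x y ∂ν := hh.lintegral_prod_right'
  calc ∫⁻ x in s, ∫⁻ y in t, f x y ∂ν ∂μ
      ≤ ∫⁻ x in s, ∫⁻ y in t, (a * g x y + b * h x y) ∂ν ∂μ :=
        setLIntegral_mono' hs fun x hx => setLIntegral_mono' ht (hfgh x hx)
    _ = ∫⁻ x in s, (a * (∫⁻ y in t, g x y ∂ν) + b * ∫⁻ y in t, h x y ∂ν) ∂μ := by
        refine lintegral_congr fun x => ?_
        have hhx : Measurable (h x) := hh.comp measurable_prodMk_left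
        rw [lintegral_add_right _ (hhx.const_mul _), lintegral_const_mul' _ _ ha,
          lintegral_const_mul _ hhx]
    _ = _ := by
        rw [lintegral_add_right _ (hh_int.const_mul _), lintegral_const_mul' _ _ ha,
          lintegral_const_mul _ hh_int]

/-- If the variable-exponent modular of order `s` is at most one, then the Gagliardo energy of order
`σ < s` and exponent `q` below the variable exponent is bounded. -/
lemma lintegral_gagliardo_le {n : ℕ} (hn : 1 ≤ n) {s σ q pm pM : ℝ} (hσs : σ < s)
    (hq : 0 < q) (hqpm : q < pm) (hpmM : pm ≤ pM) :
    ∃ C : ℝ, 0 ≤ C ∧ ∀ (Ω Ω' : Set (Rn n)), MeasurableSet Ω → MeasurableSet Ω' → Ω' ⊆ Ω →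
      Bornology.IsBounded Ω → diam Ω ≤ 1 →
      ∀ p : Rn n → Rn n → ℝ, (∀ x ∈ Ω, ∀ y ∈ Ω, pm ≤ p x y ∧ p x y ≤ pM) →
      ∀ T : ℝ, T = (volume Ω').toReal * diam Ω ^ ((s - σ) * (pM * q / (pM - q))) →
      ∀ v : Rn n → ℝ, gagModular s p Ω v ≤ 1 →
        ∫⁻ x in Ω, ∫⁻ y in Ω',
            ENNReal.ofReal (|v x - v y| ^ q / ‖x - y‖ ^ ((n : ℝ) + σ * q))
          ≤ ENNReal.ofReal ((1 + C) *
              max (T ^ ((pM - q) / (pM * q))) (T ^ ((pm - q) / (pm * q))) ^ q) := by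
  have hpM : q < pM := hqpm.trans_le hpmM
  have hP : 0 < (s - σ) * (pM * q / (pM - q)) :=
    mul_pos (by linarith) (div_pos (mul_pos (hq.trans hpM) hq) (by linarith))
  obtain ⟨C, hC, hball⟩ := exists_setLIntegral_closedBall_rpow_le hn hP
  refine ⟨C, hC, fun Ω Ω' hΩ hΩ' hsub hbdd hd1 p hp T hT v hv => ?_⟩
  set P := (s - σ) * (pM * q / (pM - q)) with hPdef
  set d := diam Ω with hd
  have hvol : volume Ω' ≠ ⊤ := (hbdd.subset hsub).measure_lt_top.ne
  rcases eq_or_ne (volume Ω') 0 with h0 | h0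
  · simp [Measure.restrict_eq_zero.2 h0]
  have hd0 : 0 < d := by
    refine diam_nonneg.lt_of_ne fun h => h0 ?_
    have : Nonempty (Fin n) := ⟨⟨0, hn⟩⟩
    have hss : Ω'.Subsingleton := fun x hx y hy => dist_le_zero.1 <|
      (dist_le_diam_of_mem hbdd (hsub hx) (hsub hy)).trans h.ge
    exact hss.measure_zero _
  have hT0 : 0 < T := by
    rw [hT]
    exact mul_pos (ENNReal.toReal_pos h0 hvol) (by positivity)
  set M := max (T ^ ((pM - q) / (pM * q))) (T ^ ((pm - q) / (pm * q))) with hMdef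
  have hM : 0 < M := lt_max_of_lt_left (by positivity)
  have hker_meas : Measurable (Function.uncurry fun x y : Rn n =>
      ENNReal.ofReal (‖x - y‖ ^ (P - n))) := by
    unfold Function.uncurry
    fun_prop
  have hTM (r : ℝ) (h1 : pm ≤ r) (h2 : r ≤ pM) : T ^ ((r - q) / (r * q)) ≤ M := by
    have hpm0 : 0 < pm := hq.trans hqpm
    have hr0 : 0 < r := hpm0.trans_le h1
    have hmono {b c : ℝ} (hb : 0 < b) (hbc : b ≤ c) : (b - q) / (b * q) ≤ (c - q) / (c * q) := by
      have hc : 0 < c := hb.trans_le hbc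
      rw [div_le_div_iff₀ (by positivity) (by positivity)]
      nlinarith [mul_nonneg (mul_nonneg hq.le hq.le) (sub_nonneg.2 hbc)]
    exact rpow_le_max_of_mem_Icc hT0 (hmono hpm0 h1) (hmono hr0 h2)
  have hdist (x : Rn n) (hx : x ∈ Ω) (y : Rn n) (hy : y ∈ Ω') : dist x y ≤ d :=
    dist_le_diam_of_mem hbdd hx (hsub hy)
  clear_value M P d
  have hsing : ∫⁻ x in Ω, ∫⁻ y in Ω', ENNReal.ofReal (‖x - y‖ ^ (P - n))
      ≤ ENNReal.ofReal (C * T) := by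
    rw [lintegral_lintegral_swap hker_meas.aemeasurable]
    calc ∫⁻ y in Ω', ∫⁻ x in Ω, ENNReal.ofReal (‖x - y‖ ^ (P - n))
        ≤ ∫⁻ _ in Ω', ENNReal.ofReal (C * d ^ P) := by
          refine setLIntegral_mono' hΩ' fun y hy => ?_
          have hΩball : Ω ⊆ closedBall y d := fun x hx => hdist x hx y hy
          exact (lintegral_mono_set hΩball).trans (hball d hd0 y)
      _ = ENNReal.ofReal (C * T) := by
          rw [setLIntegral_const, ← ENNReal.ofReal_toReal hvol,
            ← ENNReal.ofReal_mul (by positivity), hT]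
          congr 1
          ring
  have hker (x : Rn n) (hx : x ∈ Ω) (y : Rn n) (hy : y ∈ Ω') :
      ENNReal.ofReal (|v x - v y| ^ q / ‖x - y‖ ^ ((n : ℝ) + σ * q))
        ≤ ENNReal.ofReal (M ^ q)
            * ENNReal.ofReal (|v x - v y| ^ p x y / ‖x - y‖ ^ ((n : ℝ) + s * p x y))
          + ENNReal.ofReal (M ^ q / T) * ENNReal.ofReal (‖x - y‖ ^ (P - n)) := by
    obtain ⟨h1, h2⟩ := hp x hx y (hsub hy)
    have hle1 : ‖x - y‖ ≤ 1 := by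
      rw [← dist_eq_norm]
      exact (hdist x hx y hy).trans hd1
    have hdiag (h : ‖x - y‖ = 0) : |v x - v y| = 0 := by
      rw [sub_eq_zero.1 (norm_eq_zero.1 h), sub_self, abs_zero]
    have hreal := gagliardo_kernel_le (n := n) (abs_nonneg (v x - v y)) (norm_nonneg (x - y))
      hle1 hdiag hσs hM hT0 hq (hqpm.trans_le h1) h2 (hTM _ h1 h2)
    rw [← hPdef] at hreal
    rw [← ENNReal.ofReal_mul (by positivity), ← ENNReal.ofReal_mul (by positivity),
      ← ENNReal.ofReal_add (by positivity) (by positivity)]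
    exact ENNReal.ofReal_le_ofReal hreal
  have hmodular : ∫⁻ x in Ω, ∫⁻ y in Ω',
      ENNReal.ofReal (|v x - v y| ^ p x y / ‖x - y‖ ^ ((n : ℝ) + s * p x y)) ≤ 1 :=
    (lintegral_mono fun x => lintegral_mono_set hsub).trans hv
  refine (setLIntegral_setLIntegral_le_add hΩ hΩ' ENNReal.ofReal_ne_top hker_meas hker).trans ?_
  grw [hmodular, hsing]
  rw [mul_one, ← ENNReal.ofReal_mul (by positivity),
    ← ENNReal.ofReal_add (by positivity) (by positivity)]
  refine ENNReal.ofReal_le_ofReal (le_of_eq ?_)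
  field_simp

/-- the embedding lemma (Lemma 4.3); the constant depends only on
`n, s, σ, p₊, p₋, q`. -/
theorem statement7 {n : ℕ} (hn : 1 ≤ n) (s σ q pm pM : ℝ)
    (hσ : 0 < σ) (hσs : σ < s) (hs1 : s < 1)
    (hq : 1 ≤ q) (hpm : 1 < pm) (hqpm : q < pm) (hpmM : pm ≤ pM) :
    ∃ C > 0, ∀ (Ω Ω' : Set (Rn n)), MeasurableSet Ω → MeasurableSet Ω' → Ω' ⊆ Ω →
      Bornology.IsBounded Ω → Metric.diam Ω ≤ 1 →
      ∀ p : Rn n → Rn n → ℝ,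
        Measurable (fun z : Rn n × Rn n => p z.1 z.2) →
        (∀ x ∈ Ω, ∀ y ∈ Ω, p x y = p y x) →
        (∀ x ∈ Ω, ∀ y ∈ Ω, pm ≤ p x y ∧ p x y ≤ pM) →
      ∀ u : Rn n → ℝ, Measurable u →
        {lam : ℝ | 0 < lam ∧ gagModular s p Ω (fun x => u x / lam) ≤ 1}.Nonempty →
        (∫⁻ x in Ω, ∫⁻ y in Ω',
            ENNReal.ofReal (|u x - u y| ^ q / ‖x - y‖ ^ ((n : ℝ) + σ * q))) ^ (1 / q)
          ≤ ENNReal.ofReal (C *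
              max (((volume Ω').toReal
                      * Metric.diam Ω ^ ((s - σ) * (pM * q / (pM - q)))) ^ ((pM - q) / (pM * q)))
                  (((volume Ω').toReal
                      * Metric.diam Ω ^ ((s - σ) * (pM * q / (pM - q)))) ^ ((pm - q) / (pm * q)))
              * gagSeminorm s p Ω u) := by
  have hq0 : 0 < q := by linarith
  obtain ⟨C, hC, hmod⟩ := lintegral_gagliardo_le (n := n) hn hσs hq0 hqpm hpmM
  refine ⟨(1 + C) ^ (1 / q), by positivity, ?_⟩
  intro Ω Ω' hΩ hΩ' hsub hbdd hd1 p _ _ hp u _ hne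
  set T := (volume Ω').toReal * Metric.diam Ω ^ ((s - σ) * (pM * q / (pM - q))) with hT
  set M := max (T ^ ((pM - q) / (pM * q))) (T ^ ((pm - q) / (pm * q))) with hM
  have hT0 : 0 ≤ T := mul_nonneg ENNReal.toReal_nonneg (Real.rpow_nonneg diam_nonneg _)
  have hM0 : 0 ≤ M := le_max_of_le_left (Real.rpow_nonneg hT0 _)
  set L := (∫⁻ x in Ω, ∫⁻ y in Ω',
    ENNReal.ofReal (|u x - u y| ^ q / ‖x - y‖ ^ ((n : ℝ) + σ * q))) ^ (1 / q) with hL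
  have hbound : ∀ lam ∈ {lam : ℝ | 0 < lam ∧ gagModular s p Ω (fun x => u x / lam) ≤ 1},
      L ≤ ENNReal.ofReal ((1 + C) ^ (1 / q) * M * lam) := by
    rintro lam ⟨hlam, hlam1⟩
    have hscale : ∫⁻ x in Ω, ∫⁻ y in Ω',
          ENNReal.ofReal (|u x - u y| ^ q / ‖x - y‖ ^ ((n : ℝ) + σ * q))
        = ENNReal.ofReal (lam ^ q) * ∫⁻ x in Ω, ∫⁻ y in Ω',
          ENNReal.ofReal (|u x / lam - u y / lam| ^ q / ‖x - y‖ ^ ((n : ℝ) + σ * q)) := by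
      rw [← lintegral_const_mul' _ _ ENNReal.ofReal_ne_top]
      refine lintegral_congr fun x => ?_
      rw [← lintegral_const_mul' _ _ ENNReal.ofReal_ne_top]
      refine lintegral_congr fun y => ?_
      rw [← ENNReal.ofReal_mul (by positivity), ← sub_div, abs_div, abs_of_pos hlam,
        Real.div_rpow (abs_nonneg _) hlam.le]
      congr 1
      field_simp
    calc L ≤ (ENNReal.ofReal (lam ^ q) * ENNReal.ofReal ((1 + C) * M ^ q)) ^ (1 / q) := by
          rw [hL, hscale]
          gcongr
          exact hmod Ω Ω' hΩ hΩ' hsub hbdd hd1 p hp T hT _ hlam1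
      _ = ENNReal.ofReal ((1 + C) ^ (1 / q) * M * lam) := by
          rw [← ENNReal.ofReal_mul (by positivity),
            ENNReal.ofReal_rpow_of_nonneg (by positivity) (by positivity),
            Real.mul_rpow (by positivity) (by positivity),
            Real.mul_rpow (by positivity) (by positivity), one_div,
            Real.rpow_rpow_inv hlam.le hq0.ne', Real.rpow_rpow_inv hM0 hq0.ne', mul_comm]
  have hA : 0 ≤ (1 + C) ^ (1 / q) * M := by positivity
  rw [gagSeminorm]
  generalize (1 + C) ^ (1 / q) * M = A at hA hbound
  rcases hA.eq_or_lt with rfl | hA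
  · simpa using hbound _ hne.some_mem
  have hLtop : L ≠ ⊤ := ne_top_of_le_ne_top ENNReal.ofReal_ne_top (hbound _ hne.some_mem)
  rw [← ENNReal.ofReal_toReal hLtop]
  refine ENNReal.ofReal_le_ofReal ?_
  rw [← div_le_iff₀' hA]
  refine le_csInf hne fun lam hlam => ?_
  rw [div_le_iff₀' hA]
  exact ENNReal.toReal_le_of_le_ofReal (mul_nonneg hA.le hlam.1.le) (hbound lam hlam)
end
end

section
/- Let {Y_j}_{j≥0} be a sequence of nonnegative real numbers satisfying Y_{j+1} ≤ C·b^j·max{ Y_j^{1+β₁}, Y_j^{1+β₂}, …, Y_j^{1+β_N} } for all j ≥ 0, for some constants C ≥ 1, b > 1, N ∈ ℕ, and β₁ ≥ β₂ ≥ … ≥ β_N > 0. If Y₀ ≤ min{ C^{−1/β_N}·b^{−1/β_N²}, C^{−1/β₁} }, then Y_j ≤ C^{−1/β_N}·b^{−1/β_N² − j/β_N} for all j ≥ 0; in particular Y_j → 0 as j → ∞. -/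
open MeasureTheory Metric Set Filter
open scoped ENNReal Topology
noncomputable section

/-- Fast geometric convergence with a single exponent. -/
lemma fast_geometric_convergence {C b β : ℝ} (hC : 1 ≤ C) (hb : 1 < b) (hβ : 0 < β)
    {Y : ℕ → ℝ} (hY : ∀ j, 0 ≤ Y j)
    (hrec : ∀ j : ℕ, Y j ≤ 1 → Y (j + 1) ≤ C * b ^ (j : ℝ) * Y j ^ (1 + β))
    (h0 : Y 0 ≤ C ^ (-1 / β) * b ^ (-1 / β ^ 2)) (j : ℕ) :
    Y j ≤ C ^ (-1 / β) * b ^ (-1 / β ^ 2 - (j : ℝ) / β) := by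
  have hC0 : 0 < C := by linarith
  have hb0 : 0 < b := by linarith
  induction j with
  | zero => simpa using h0
  | succ j ih =>
    have hCpow : C ^ (-1 / β) ≤ 1 :=
      Real.rpow_le_one_of_one_le_of_nonpos hC
        (div_nonpos_of_nonpos_of_nonneg (by norm_num) hβ.le)
    have hbpow : b ^ (-1 / β ^ 2 - (j : ℝ) / β) ≤ 1 := by
      refine Real.rpow_le_one_of_one_le_of_nonpos hb.le ?_
      have h₁ : -1 / β ^ 2 ≤ 0 := div_nonpos_of_nonpos_of_nonneg (by norm_num) (by positivity)
      have h₂ : 0 ≤ (j : ℝ) / β := by positivity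
      linarith
    have hYj : Y j ≤ 1 := ih.trans (mul_le_one₀ hCpow (by positivity) hbpow)
    calc Y (j + 1) ≤ C * b ^ (j : ℝ) * Y j ^ (1 + β) := hrec j hYj
      _ ≤ C * b ^ (j : ℝ) * (C ^ (-1 / β) * b ^ (-1 / β ^ 2 - (j : ℝ) / β)) ^ (1 + β) := by
        have := hY j
        gcongr
      _ = C ^ (1 + -1 / β * (1 + β)) *
          b ^ ((j : ℝ) + (-1 / β ^ 2 - (j : ℝ) / β) * (1 + β)) := by
        rw [Real.mul_rpow (by positivity) (by positivity), ← Real.rpow_mul hC0.le,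
          ← Real.rpow_mul hb0.le, Real.rpow_add hC0, Real.rpow_add hb0, Real.rpow_one]
        ring
      _ = C ^ (-1 / β) * b ^ (-1 / β ^ 2 - ((j + 1 : ℕ) : ℝ) / β) := by
        congr 2
        · field_simp
          ring
        · push_cast
          field_simp
          ring

/-- the iteration lemma (Lemma 4.4). -/
theorem statement8 (C b : ℝ) (hC : 1 ≤ C) (hb : 1 < b) (N : ℕ) (hN : 0 < N)
    (β : Fin N → ℝ) (hβpos : ∀ i, 0 < β i)
    (hβmono : ∀ i j : Fin N, i ≤ j → β j ≤ β i)
    (β₁ βN : ℝ) (hβ₁ : β₁ = β ⟨0, hN⟩) (hβN : βN = β ⟨N - 1, Nat.sub_lt hN Nat.one_pos⟩)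
    (Y : ℕ → ℝ) (hY : ∀ j, 0 ≤ Y j)
    (hrec : ∀ j : ℕ, ∃ i : Fin N, Y (j + 1) ≤ C * b ^ (j : ℝ) * Y j ^ (1 + β i))
    (h0 : Y 0 ≤ min (C ^ (-1 / βN) * b ^ (-1 / βN ^ 2)) (C ^ (-1 / β₁))) :
    (∀ j : ℕ, Y j ≤ C ^ (-1 / βN) * b ^ (-1 / βN ^ 2 - (j : ℝ) / βN)) ∧
      Filter.Tendsto Y Filter.atTop (nhds 0) := by
  subst hβ₁ hβN
  set βN := β ⟨N - 1, Nat.sub_lt hN Nat.one_pos⟩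
  have hβ : 0 < βN := hβpos _
  have hb0 : 0 < b := by linarith
  have hC0 : 0 < C := by linarith
  have hbound : ∀ j : ℕ, Y j ≤ C ^ (-1 / βN) * b ^ (-1 / βN ^ 2 - (j : ℝ) / βN) := by
    refine fast_geometric_convergence hC hb hβ hY (fun j hj => ?_) (h0.trans (min_le_left _ _))
    obtain ⟨i, hi⟩ := hrec j
    have hle : βN ≤ β i := hβmono i _ (Fin.mk_le_mk.mpr (by omega))
    refine hi.trans (mul_le_mul_of_nonneg_left ?_ (by positivity))
    exact Real.rpow_le_rpow_of_exponent_ge' (hY j) hj (by positivity) (by linarith)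
  refine ⟨hbound, squeeze_zero hY hbound ?_⟩
  have hgeom : ∀ j : ℕ, C ^ (-1 / βN) * b ^ (-1 / βN ^ 2 - (j : ℝ) / βN) =
      C ^ (-1 / βN) * b ^ (-1 / βN ^ 2) * (b ^ (-1 / βN)) ^ j := by
    intro j
    rw [← Real.rpow_natCast _ j, ← Real.rpow_mul hb0.le, mul_assoc, ← Real.rpow_add hb0]
    ring_nf
  simp_rw [hgeom]
  have hlt : b ^ (-1 / βN) < 1 :=
    Real.rpow_lt_one_of_one_lt_of_neg hb (div_neg_of_neg_of_pos (by norm_num) hβ)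
  simpa using (tendsto_pow_atTop_nhds_zero_of_lt_one (by positivity) hlt).const_mul
    (C ^ (-1 / βN) * b ^ (-1 / βN ^ 2))
end
end

section
/- Let 0 < σ < s < 1, γ ∈ (0,1), L > 0, and fix bounds for the exponent. There exists δ ∈ (0,1/8], depending only on n, s, σ, γ, L and the quantities p₊(B_R×ℝⁿ), p₋(B_R×ℝⁿ), such that the following holds. Let B_R = B_R(x₀) ⊂ ℝⁿ with R ∈ (0,1) and H > 0; assume p satisfies (P1) with constant L and (P2) in B_R, that H^{p₊−p₋} ≤ 2 and p₊ < n·p₋/(n−σ·p₋), where p₊ = p₊(B_R×B_R) and p₋ = p₋(B_R×B_R). Let u ∈ W^{s,p(·,·)}(ℝⁿ) be a weak supersolution of (−Δ)^s_{p(·,·)}u = 0 in B_R with 0 ≤ u ≤ 2H a.e. in B_R and |B_{R/2}(x₀) ∩ {u ≥ H}| ≥ γ|B_{R/2}(x₀)|. If moreover R^s ≤ δH and sup_{x∈B_{3R/4}(x₀)} ∫_{ℝⁿ∖B_R} u₋(y)^{p(x,y)−1} |y−x₀|^{−n−s·p(x,y)} dy ≤ R^{−s·p₊}(δH)^{p₊−1}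 + R^{−s·p₋}(δH)^{p₋−1}, then u ≥ δH almost everywhere in B_{R/4}(x₀). -/
open MeasureTheory Metric Set Filter
open scoped ENNReal Topology
noncomputable section

theorem signedPow_of_nonneg {q a : ℝ} (hq : 1 < q) (ha : 0 ≤ a) :
    |a| ^ (q - 2) * a = a ^ (q - 1) := by
  rcases ha.eq_or_lt with rfl | h
  · rw [Real.zero_rpow (by linarith), mul_zero]
  · rw [abs_of_pos h, show q - 1 = q - 2 + 1 by ring, Real.rpow_add_one h.ne']

theorem signedPow_of_nonpos {q a : ℝ} (hq : 1 < q) (ha : a ≤ 0) :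
    |a| ^ (q - 2) * a = -(-a) ^ (q - 1) := by
  rw [← signedPow_of_nonneg hq (neg_nonneg.2 ha), abs_neg]; ring

theorem signedPow_le {q a c : ℝ} (hq : 1 < q) (hc : 0 ≤ c) (h : a ≤ c) :
    |a| ^ (q - 2) * a ≤ c ^ (q - 1) := by
  rcases le_total 0 a with ha | ha
  · rw [signedPow_of_nonneg hq ha]
    exact Real.rpow_le_rpow ha h (by linarith)
  · rw [signedPow_of_nonpos hq ha]
    have := Real.rpow_nonneg (neg_nonneg.2 ha) (q - 1)
    have := Real.rpow_nonneg hc (q - 1)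
    linarith

theorem rpow_sub_one_mul_self {q a : ℝ} (hq : 1 < q) (ha : 0 ≤ a) :
    a ^ (q - 1) * a = a ^ q := by
  rcases ha.eq_or_lt with rfl | h
  · rw [Real.zero_rpow (by linarith : q ≠ 0), mul_zero]
  · rw [← Real.rpow_add_one h.ne', sub_add_cancel]

theorem rpow_sub_one_mul_le {q a b : ℝ} (hq : 1 < q) (ha : 0 ≤ a) (hb : 0 ≤ b) :
    a ^ (q - 1) * b ≤ max a b ^ q := by
  rw [← rpow_sub_one_mul_self hq (le_max_of_le_left ha)]
  exact mul_le_mul (Real.rpow_le_rpow ha (le_max_left _ _) (by linarith)) (le_max_right _ _) hb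
    (by positivity)

theorem abs_signedPow_mul {q a b : ℝ} (hq : 1 < q) :
    |(|a| ^ (q - 2) * a * b)| ≤ |a| ^ q + |b| ^ q := by
  have h : |(|a| ^ (q - 2) * a * b)| = |a| ^ (q - 1) * |b| := by
    rw [abs_mul, abs_mul, abs_of_nonneg (Real.rpow_nonneg (abs_nonneg a) _)]
    congr 1
    have := signedPow_of_nonneg hq (abs_nonneg a)
    rwa [abs_abs] at this
  rw [h]
  refine (rpow_sub_one_mul_le hq (abs_nonneg a) (abs_nonneg b)).trans ?_
  have := Real.rpow_nonneg (abs_nonneg a) q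
  have := Real.rpow_nonneg (abs_nonneg b) q
  rcases max_choice |a| |b| with h | h <;> rw [h] <;> linarith

/-- Pairs of points at which the test function is positive. -/
theorem signedPow_mul_sub_le {q a b : ℝ} (hq : 1 < q) :
    |a| ^ (q - 2) * a * (b - a) ≤ |b| ^ q := by
  have h0 := signedPow_of_nonneg hq (abs_nonneg a)
  rw [abs_abs] at h0
  have hJ : |a| ^ (q - 2) * a * a = |a| ^ q := by
    rw [← rpow_sub_one_mul_self hq (abs_nonneg a), ← h0, mul_assoc, mul_assoc, abs_mul_abs_self]
  have hb : |a| ^ (q - 2) * a * b ≤ |a| ^ (q - 1) * |b| := by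
    rw [← h0, mul_assoc, mul_assoc, ← abs_mul]
    exact mul_le_mul_of_nonneg_left (le_abs_self _) (Real.rpow_nonneg (abs_nonneg a) _)
  have hm := rpow_sub_one_mul_le hq (abs_nonneg a) (abs_nonneg b)
  have := Real.rpow_nonneg (abs_nonneg a) q
  have := Real.rpow_nonneg (abs_nonneg b) q
  rcases max_choice |a| |b| with h | h <;> rw [h] at hm <;> linarith

/-- Pairs consisting of a point where the test function is positive and a point of the ball
where it vanishes. -/
theorem signedPow_mul_add_le {q a b f : ℝ} (hq : 1 < q) (hf : 0 < f) (h : a ≤ b - f) :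
    |a| ^ (q - 2) * a * f + 2 ^ (-q) * f * max f (-a) ^ (q - 1) ≤ 2 * |b| ^ q := by
  have hbq := Real.rpow_nonneg (abs_nonneg b) q
  by_cases hc : f / 2 ≤ -a
  · rw [signedPow_of_nonpos hq (by linarith)]
    have h1 : max f (-a) ^ (q - 1) ≤ (2 * (-a)) ^ (q - 1) :=
      Real.rpow_le_rpow (le_max_of_le_left hf.le) (max_le (by linarith) (by linarith))
        (by linarith)
    rw [Real.mul_rpow (by norm_num) (by linarith)] at h1
    have h2 : (2:ℝ) ^ (-q) * 2 ^ (q - 1) = 1 / 2 := by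
      rw [← Real.rpow_add (by norm_num), show -q + (q - 1) = -1 by ring, Real.rpow_neg_one]
      norm_num
    have h3 : (2:ℝ) ^ (-q) * f * max f (-a) ^ (q - 1)
        ≤ 2 ^ (-q) * f * (2 ^ (q - 1) * (-a) ^ (q - 1)) :=
      mul_le_mul_of_nonneg_left h1 (by positivity)
    have h4 : (2:ℝ) ^ (-q) * f * (2 ^ (q - 1) * (-a) ^ (q - 1)) = 1 / 2 * (f * (-a) ^ (q - 1)) := by
      rw [← h2]; ring
    have h5 : 0 ≤ f * (-a) ^ (q - 1) :=
      mul_nonneg hf.le (Real.rpow_nonneg (by linarith) _)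
    linarith
  · push Not at hc
    have hb : f / 2 < b := by linarith
    rw [abs_of_pos (by linarith : 0 < b)] at hbq ⊢
    have h1 : 2 ^ (-q) * f * max f (-a) ^ (q - 1) ≤ b ^ q := by
      rw [max_eq_left (by linarith), mul_assoc, mul_comm f, rpow_sub_one_mul_self hq hf.le,
        Real.rpow_neg (by norm_num), ← div_eq_inv_mul, ← Real.div_rpow hf.le (by norm_num)]
      exact Real.rpow_le_rpow (by linarith) hb.le (by linarith)
    have h2 : |a| ^ (q - 2) * a * f ≤ b ^ q := by
      rcases le_total a 0 with ha | ha
      · rw [signedPow_of_nonpos hq ha]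
        have := mul_nonneg (Real.rpow_nonneg (neg_nonneg.2 ha) (q - 1)) hf.le
        linarith
      · have := mul_le_mul_of_nonneg_right
          (signedPow_le hq (by linarith : 0 ≤ b) (by linarith : a ≤ b)) hf.le
        refine this.trans ((rpow_sub_one_mul_le hq (by linarith) hf.le).trans ?_)
        rw [max_eq_left (by linarith)]
    linarith

/-- Pairs consisting of a point where the test function is positive and a point outside the
ball. -/
theorem signedPow_mul_le {q a b f m : ℝ} (hq : 1 < q) (hf : 0 < f) (hfb : f ≤ b) (hm : 0 ≤ m)
    (h : a ≤ b - f + m) :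
    |a| ^ (q - 2) * a * f ≤ 2 ^ (q - 1) * (b ^ q + m ^ (q - 1) * f) := by
  have hb : 0 ≤ b := by linarith
  have hM : 0 ≤ max b m := le_max_of_le_left hb
  have h1 : |a| ^ (q - 2) * a ≤ (2 * max b m) ^ (q - 1) :=
    signedPow_le hq (by linarith) (by linarith [le_max_left b m, le_max_right b m])
  have h2 : max b m ^ (q - 1) ≤ b ^ (q - 1) + m ^ (q - 1) := by
    have := Real.rpow_nonneg hb (q - 1)
    have := Real.rpow_nonneg hm (q - 1)
    rcases max_choice b m with h | h <;> rw [h] <;> linarith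
  rw [Real.mul_rpow (by norm_num) hM] at h1
  calc |a| ^ (q - 2) * a * f ≤ 2 ^ (q - 1) * max b m ^ (q - 1) * f :=
        mul_le_mul_of_nonneg_right h1 hf.le
    _ ≤ 2 ^ (q - 1) * (b ^ (q - 1) + m ^ (q - 1)) * f := by gcongr
    _ = 2 ^ (q - 1) * (b ^ (q - 1) * f + m ^ (q - 1) * f) := by ring
    _ ≤ 2 ^ (q - 1) * (b ^ q + m ^ (q - 1) * f) := by
        have := rpow_sub_one_mul_le hq hb hf.le
        rw [max_eq_left hfb] at this
        gcongr

/-- Radial profile dominating the rescaled energy density of a bounded Lipschitz function. -/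
def decayProfile (n : ℕ) (s ρ : ℝ) : ℝ :=
  if ρ ≤ 1 then ρ ^ (1 - s - n) else ρ ^ (-s - n)

theorem measurable_decayProfile (n : ℕ) (s : ℝ) : Measurable (decayProfile n s) :=
  Measurable.ite measurableSet_Iic (by fun_prop) (by fun_prop)

theorem decayProfile_nonneg (n : ℕ) (s : ℝ) {ρ : ℝ} (h : 0 ≤ ρ) : 0 ≤ decayProfile n s ρ := by
  unfold decayProfile
  split_ifs <;> positivity

theorem integrable_decayProfile {n : ℕ} (hn : 1 ≤ n) {s : ℝ} (hs0 : 0 < s) (hs1 : s < 1) :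
    Integrable (fun z : Rn n => decayProfile n s ‖z‖) := by
  have : Nonempty (Fin n) := ⟨⟨0, hn⟩⟩
  have key : IntegrableOn (fun y : ℝ => y ^ (Module.finrank ℝ (Rn n) - 1) • decayProfile n s y)
      (Ioi 0) := by
    rw [← Ioc_union_Ioi_eq_Ioi zero_le_one]
    have hpow : ∀ y : ℝ, 0 < y → ∀ e : ℝ,
        y ^ (Module.finrank ℝ (Rn n) - 1) * y ^ (e - n) = y ^ (e - 1) := by
      intro y hy e
      rw [finrank_euclideanSpace_fin, ← Real.rpow_natCast, ← Real.rpow_add hy]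
      congr 1
      push_cast [Nat.cast_sub hn]
      ring
    refine IntegrableOn.union ?_ ?_
    · have h := (intervalIntegral.intervalIntegrable_rpow' (a := 0) (b := 1)
        (r := (1 - s) - 1) (by linarith)).1
      refine h.congr_fun (fun y hy => ?_) measurableSet_Ioc
      simp only [decayProfile, smul_eq_mul, if_pos hy.2]
      exact (hpow y hy.1 (1 - s)).symm
    · have h := integrableOn_Ioi_rpow_of_lt (a := -s - 1) (by linarith) zero_lt_one
      refine h.congr_fun (fun y hy => ?_) measurableSet_Ioi
      simp only [decayProfile, smul_eq_mul, if_neg (not_le.2 (mem_Ioi.1 hy))]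
      exact (hpow y (zero_lt_one.trans hy) (-s)).symm
  exact (integrable_fun_norm_addHaar volume).2 key

theorem lintegral_comp_smul_Rn {n : ℕ} {f : Rn n → ℝ≥0∞} (hf : Measurable f) {r : ℝ}
    (hr : 0 < r) :
    ∫⁻ z, f (r • z) = ENNReal.ofReal ((r ^ n)⁻¹) * ∫⁻ z, f z := by
  rw [← lintegral_map (μ := volume) (g := fun z : Rn n => r • z) hf (by fun_prop),
    Measure.map_addHaar_smul _ hr.ne', lintegral_smul_measure, finrank_euclideanSpace_fin,
    abs_of_pos (by positivity), smul_eq_mul]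

theorem exists_lintegral_decayProfile_le {n : ℕ} (hn : 1 ≤ n) {s : ℝ} (hs0 : 0 < s)
    (hs1 : s < 1) :
    ∃ C : ℝ, 0 ≤ C ∧ ∀ (R : ℝ) (x : Rn n), 0 < R →
      ∫⁻ y, ENNReal.ofReal (R ^ (-(n : ℝ)) * decayProfile n s (‖x - y‖ / R))
        ≤ ENNReal.ofReal C := by
  have hint := integrable_decayProfile hn hs0 hs1
  refine ⟨∫ z : Rn n, decayProfile n s ‖z‖,
    integral_nonneg fun z => decayProfile_nonneg _ _ (norm_nonneg z), fun R x hR => ?_⟩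
  have hmeas : Measurable fun z : Rn n => ENNReal.ofReal (decayProfile n s ‖z‖) :=
    ((measurable_decayProfile n s).comp measurable_norm).ennreal_ofReal
  rw [ofReal_integral_eq_lintegral_ofReal hint
    (Eventually.of_forall fun z => decayProfile_nonneg _ _ (norm_nonneg z))]
  have h1 := lintegral_sub_left_eq_self (μ := (volume : Measure (Rn n)))
    (fun z => ENNReal.ofReal (R ^ (-(n : ℝ)) * decayProfile n s (‖z‖ / R))) x
  rw [h1]
  have h2 : ∀ z : Rn n, ENNReal.ofReal (R ^ (-(n : ℝ)) * decayProfile n s (‖z‖ / R))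
      = ENNReal.ofReal (R ^ (-(n : ℝ))) * ENNReal.ofReal (decayProfile n s ‖R⁻¹ • z‖) := by
    intro z
    rw [ENNReal.ofReal_mul (by positivity), norm_smul, norm_inv, Real.norm_of_nonneg hR.le,
      ← div_eq_inv_mul]
  simp_rw [h2]
  rw [lintegral_const_mul _ (by exact hmeas.comp (measurable_const_smul R⁻¹)),
    lintegral_comp_smul_Rn hmeas (inv_pos.2 hR), ← mul_assoc,
    ← ENNReal.ofReal_mul (by positivity), Real.rpow_neg hR.le, Real.rpow_natCast, inv_pow, inv_inv,
    inv_mul_cancel₀ (by positivity), ENNReal.ofReal_one, one_mul]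

/-- The energy density of a function that is bounded by `8ℓ` and `8ℓ / R`-Lipschitz. -/
theorem energyDensity_le_decayProfile {n : ℕ} {s : ℝ} (hs0 : 0 < s) (hs1 : s < 1)
    {q PM R ℓ T d b : ℝ} (hq1 : 1 < q) (hqM : q ≤ PM) (hR : 0 < R) (hℓ : 0 < ℓ)
    (hT : (ℓ / R ^ s) ^ q ≤ T) (hd : 0 ≤ d) (hb : |b| ≤ 8 * ℓ * min (d / R) 1) :
    |b| ^ q / d ^ ((n : ℝ) + s * q)
      ≤ 8 ^ PM * T * (R ^ (-(n : ℝ)) * decayProfile n s (d / R)) := by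
  have hT0 : 0 ≤ T := le_trans (by positivity) hT
  rcases hd.eq_or_lt with rfl | hd
  · have : b = 0 := by simpa using hb
    subst this
    rw [abs_zero, Real.zero_rpow (by linarith), zero_div]
    have := decayProfile_nonneg n s (ρ := 0 / R) (by simp)
    positivity
  set ρ := d / R with hρ
  have hρ0 : 0 < ρ := div_pos hd hR
  have hdρ : d = R * ρ := by rw [hρ]; field_simp
  have hmin : 0 ≤ min ρ 1 := le_min hρ0.le zero_le_one
  have h1 : |b| ^ q ≤ (8 * ℓ * min ρ 1) ^ q :=
    Real.rpow_le_rpow (abs_nonneg _) hb (by linarith)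
  have h2 : (8 * ℓ * min ρ 1) ^ q / d ^ ((n : ℝ) + s * q)
      = 8 ^ q * (ℓ / R ^ s) ^ q * (R ^ (-(n : ℝ)) * (min ρ 1 ^ q * ρ ^ (-(n + s * q)))) := by
    rw [hdρ, Real.mul_rpow hR.le hρ0.le, Real.mul_rpow (by positivity) hmin,
      Real.mul_rpow (by norm_num) hℓ.le, Real.div_rpow hℓ.le (by positivity),
      ← Real.rpow_mul hR.le, Real.rpow_add hR, Real.rpow_neg hR.le, Real.rpow_neg hρ0.le]
    field_simp
  have h3 : min ρ 1 ^ q * ρ ^ (-(n + s * q)) ≤ decayProfile n s ρ := by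
    unfold decayProfile
    split_ifs with h
    · rw [min_eq_left h, ← Real.rpow_add hρ0]
      exact Real.rpow_le_rpow_of_exponent_ge hρ0 h (by nlinarith)
    · rw [min_eq_right (not_le.1 h).le, Real.one_rpow, one_mul]
      exact Real.rpow_le_rpow_of_exponent_le (not_le.1 h).le (by nlinarith)
  calc |b| ^ q / d ^ ((n : ℝ) + s * q) ≤ (8 * ℓ * min ρ 1) ^ q / d ^ ((n : ℝ) + s * q) := by
        gcongr
    _ = _ := h2
    _ ≤ _ := by
        have : (8:ℝ) ^ q ≤ 8 ^ PM := Real.rpow_le_rpow_of_exponent_le (by norm_num) hqM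
        gcongr

/-- Truncated cone with vertex `x₀`, supported in `B_{R/2}(x₀)`. -/
def tent {n : ℕ} (x₀ : Rn n) (R ℓ c : ℝ) (x : Rn n) : ℝ :=
  max (4 * ℓ * (1 - 2 * (‖x - x₀‖ / R)) - c) 0

/-- The test function `(v - u₊)₊`. -/
def testFn {n : ℕ} (v u : Rn n → ℝ) (x : Rn n) : ℝ :=
  max (v x - max (u x) 0) 0

section Tent

variable {n : ℕ} {x₀ : Rn n} {R ℓ c : ℝ}

theorem tent_nonneg (x : Rn n) : 0 ≤ tent x₀ R ℓ c x := le_max_right _ _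

theorem tent_le (hR : 0 < R) (hℓ : 0 < ℓ) (hc : 0 ≤ c) (x : Rn n) : tent x₀ R ℓ c x ≤ 4 * ℓ := by
  refine max_le ?_ (by positivity)
  have : 0 ≤ ‖x - x₀‖ / R := by positivity
  nlinarith

theorem tent_eq_zero (hR : 0 < R) (hℓ : 0 < ℓ) (hc : 0 ≤ c) {x : Rn n} (hx : x ∉ ball x₀ (R / 2)) :
    tent x₀ R ℓ c x = 0 := by
  refine max_eq_right ?_
  rw [mem_ball, dist_eq_norm, not_lt] at hx
  have : 1 / 2 ≤ ‖x - x₀‖ / R := by rw [le_div_iff₀ hR]; linarith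
  nlinarith

theorem continuous_tent : Continuous (tent x₀ R ℓ c) := by
  unfold tent
  fun_prop

theorem abs_tent_sub_le (hR : 0 < R) (hℓ : 0 < ℓ) (hc : 0 ≤ c) (x y : Rn n) :
    |tent x₀ R ℓ c x - tent x₀ R ℓ c y| ≤ 8 * ℓ * min (‖x - y‖ / R) 1 := by
  rw [mul_min_of_nonneg _ _ (by positivity : 0 ≤ 8 * ℓ)]
  refine le_min ?_ ?_
  · refine (abs_max_sub_max_le_abs _ _ _).trans ?_
    have h1 : |‖x - x₀‖ / R - ‖y - x₀‖ / R| ≤ ‖x - y‖ / R := by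
      rw [← sub_div, abs_div, abs_of_pos hR]
      gcongr
      simpa using abs_norm_sub_norm_le (x - x₀) (y - x₀)
    rw [show 4 * ℓ * (1 - 2 * (‖x - x₀‖ / R)) - c - (4 * ℓ * (1 - 2 * (‖y - x₀‖ / R)) - c)
      = -(8 * ℓ * (‖x - x₀‖ / R - ‖y - x₀‖ / R)) by ring, abs_neg, abs_mul,
      abs_of_pos (by positivity : 0 < 8 * ℓ)]
    gcongr
  · have h1 := tent_le (x₀ := x₀) hR hℓ hc x
    have h2 := tent_le (x₀ := x₀) hR hℓ hc y
    have h3 := tent_nonneg (x₀ := x₀) (R := R) (ℓ := ℓ) (c := c) x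
    have h4 := tent_nonneg (x₀ := x₀) (R := R) (ℓ := ℓ) (c := c) y
    rw [abs_le]
    constructor <;> linarith

end Tent

section TestFn

variable {n : ℕ} {u v : Rn n → ℝ}

theorem testFn_nonneg (x : Rn n) : 0 ≤ testFn v u x := le_max_right _ _

theorem testFn_le (hv : ∀ x, 0 ≤ v x) (x : Rn n) : testFn v u x ≤ v x :=
  max_le (by linarith [le_max_right (u x) 0]) (hv x)

theorem measurable_testFn (hv : Measurable v) (hu : Measurable u) : Measurable (testFn v u) :=
  (hv.sub (hu.max measurable_const)).max measurable_const

theorem abs_testFn_sub_le (x y : Rn n) :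
    |testFn v u x - testFn v u y| ≤ |v x - v y| + |u x - u y| := by
  refine (abs_max_sub_max_le_abs _ _ _).trans ?_
  rw [show v x - max (u x) 0 - (v y - max (u y) 0) = (v x - v y) - (max (u x) 0 - max (u y) 0) by
    ring]
  exact (abs_sub (v x - v y) (max (u x) 0 - max (u y) 0)).trans
    (add_le_add_right (abs_max_sub_max_le_abs _ _ _) _)

end TestFn

/-- Numerator of the coercive part of the energy inequality. -/
def coerciveNum {n : ℕ} (p : Rn n → Rn n → ℝ) (v u : Rn n → ℝ) (B : Set (Rn n)) (x y : Rn n) : ℝ :=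
  open Classical in
  if 0 < testFn v u x ∧ y ∈ B ∧ testFn v u y = 0 then
    2 ^ (-p x y) * testFn v u x * max (testFn v u x) (u y - u x) ^ (p x y - 1)
  else 0

/-- Numerator of the error terms of the energy inequality. -/
def defectNum {n : ℕ} (p : Rn n → Rn n → ℝ) (PM : ℝ) (v u : Rn n → ℝ) (B : Set (Rn n))
    (x y : Rn n) : ℝ :=
  open Classical in
  if 0 < testFn v u x then
    2 * 2 ^ PM * (|v x - v y| ^ p x y
      + if y ∈ B then 0 else max (-u y) 0 ^ (p x y - 1) * testFn v u x)
  else 0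

section Pointwise

variable {n : ℕ} {p : Rn n → Rn n → ℝ} {PM : ℝ} {v u : Rn n → ℝ} {B : Set (Rn n)}

theorem coerciveNum_nonneg (x y : Rn n) : 0 ≤ coerciveNum p v u B x y := by
  unfold coerciveNum
  split_ifs with h
  · have := le_max_of_le_left (c := u y - u x) h.1.le
    have := h.1.le
    positivity
  · rfl

theorem defectNum_nonneg (x y : Rn n) : 0 ≤ defectNum p PM v u B x y := by
  unfold defectNum
  have := testFn_nonneg (v := v) (u := u) x
  split_ifs <;> positivity

theorem energy_add_coerciveNum_le_of_pos {x y : Rn n} (hp1 : 1 < p x y) (hpM : p x y ≤ PM)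
    (hv : ∀ x, 0 ≤ v x) (hvB : ∀ x, x ∉ B → v x = 0) (hx : x ∈ B → 0 ≤ u x)
    (hy : y ∈ B → 0 ≤ u y) (hφ : 0 < testFn v u x) :
    |u x - u y| ^ (p x y - 2) * (u x - u y) * (testFn v u x - testFn v u y)
      + coerciveNum p v u B x y ≤ defectNum p PM v u B x y := by
  set q := p x y with hq
  have hPM : (1:ℝ) ≤ 2 ^ PM := Real.one_le_rpow (by norm_num) (by linarith)
  have hxB : x ∈ B := by
    by_contra h
    linarith [testFn_le (u := u) hv x, hvB x h]
  have hux := hx hxB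
  have hφx : testFn v u x = v x - u x := by
    have h := hφ
    unfold testFn at h ⊢
    rw [max_eq_left hux] at h ⊢
    rcases lt_max_iff.1 h with h | h
    · exact max_eq_left h.le
    · exact absurd h (lt_irrefl _)
  rw [defectNum, if_pos hφ]
  by_cases hφy : testFn v u y = 0
  · have hvy : v y ≤ max (u y) 0 := by
      have : v y - max (u y) 0 ≤ testFn v u y := le_max_left _ _
      linarith
    rw [hφy, sub_zero]
    by_cases hyB : y ∈ B
    · rw [max_eq_left (hy hyB)] at hvy
      have := signedPow_mul_add_le (q := q) (a := u x - u y) (b := v x - v y) hp1 hφ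
        (by rw [hφx]; linarith)
      rw [coerciveNum, if_pos ⟨hφ, hyB, hφy⟩, if_pos hyB, add_zero]
      rw [neg_sub] at this
      refine this.trans ?_
      have h0 := Real.rpow_nonneg (abs_nonneg (v x - v y)) q
      nlinarith
    · rw [coerciveNum, if_neg (by tauto), if_neg hyB, add_zero, hvB y hyB, sub_zero,
        abs_of_nonneg (hv x)]
      have hm : -u y ≤ max (-u y) 0 := le_max_left _ _
      have hm0 : 0 ≤ max (-u y) 0 := le_max_right _ _
      refine (signedPow_mul_le (q := q) (b := v x) (m := max (-u y) 0) hp1 hφ (testFn_le hv x) hm0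
        (by rw [hφx]; linarith)).trans ?_
      have h2 : (2:ℝ) ^ (q - 1) ≤ 2 * 2 ^ PM := by
        have : (2:ℝ) ^ (q - 1) ≤ 2 ^ PM :=
          Real.rpow_le_rpow_of_exponent_le (by norm_num) (by linarith)
        linarith
      have := hv x
      gcongr
  · have hφy' : 0 < testFn v u y := (testFn_nonneg y).lt_of_ne' hφy
    have hyB : y ∈ B := by
      by_contra h
      linarith [testFn_le (u := u) hv y, hvB y h]
    have hφy2 : testFn v u y = v y - u y := by
      have h := hφy'
      unfold testFn at h ⊢
      rw [max_eq_left (hy hyB)] at h ⊢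
      rcases lt_max_iff.1 h with h | h
      · exact max_eq_left h.le
      · exact absurd h (lt_irrefl _)
    rw [coerciveNum, if_neg (by tauto), add_zero, if_pos hyB, add_zero, hφx, hφy2,
      show v x - u x - (v y - u y) = (v x - v y) - (u x - u y) by ring]
    refine (signedPow_mul_sub_le hp1).trans ?_
    have h0 := Real.rpow_nonneg (abs_nonneg (v x - v y)) q
    nlinarith

theorem energy_add_coerciveNum_le {x y : Rn n} (hp1 : 1 < p x y) (hpM : p x y ≤ PM)
    (hps : p x y = p y x)
    (hv : ∀ x, 0 ≤ v x) (hvB : ∀ x, x ∉ B → v x = 0) (hx : x ∈ B → 0 ≤ u x)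
    (hy : y ∈ B → 0 ≤ u y) :
    |u x - u y| ^ (p x y - 2) * (u x - u y) * (testFn v u x - testFn v u y)
      + coerciveNum p v u B x y ≤ defectNum p PM v u B x y + defectNum p PM v u B y x := by
  rcases (testFn_nonneg (v := v) (u := u) x).eq_or_lt with hφx | hφx
  · have hc : coerciveNum p v u B x y = 0 := by
      rw [coerciveNum, if_neg (by rw [← hφx]; simp)]
    rw [hc, add_zero]
    refine le_trans ?_ (le_add_of_nonneg_left (defectNum_nonneg x y))
    rcases (testFn_nonneg (v := v) (u := u) y).eq_or_lt with hφy | hφy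
    · rw [← hφx, ← hφy, sub_zero, mul_zero]
      exact defectNum_nonneg y x
    · have := energy_add_coerciveNum_le_of_pos (hps ▸ hp1) (hps ▸ hpM) hv hvB hy hx hφy
      rw [hps, ← abs_neg, neg_sub]
      have h0 := coerciveNum_nonneg (p := p) (v := v) (u := u) (B := B) y x
      linarith
  · exact (energy_add_coerciveNum_le_of_pos hp1 hpM hv hvB hx hy hφx).trans
      (le_add_of_nonneg_right (defectNum_nonneg y x))

end Pointwise

theorem lintegral_le_lintegral_of_integral_nonneg {α : Type*} [MeasurableSpace α] {μ : Measure α}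
    {g : α → ℝ} {f h : α → ℝ≥0∞} (hg : Integrable g μ) (h0 : 0 ≤ ∫ z, g z ∂μ)
    (hle : ∀ᵐ z ∂μ, ENNReal.ofReal (g z) + f z ≤ h z + ENNReal.ofReal (-g z)) :
    ∫⁻ z, f z ∂μ ≤ ∫⁻ z, h z ∂μ := by
  have hpos : AEMeasurable (fun z => ENNReal.ofReal (g z)) μ := hg.aemeasurable.ennreal_ofReal
  have hneg : AEMeasurable (fun z => ENNReal.ofReal (-g z)) μ := hg.neg.aemeasurable.ennreal_ofReal
  have hfin : ∫⁻ z, ENNReal.ofReal (g z) ∂μ ≠ ⊤ := (hg.lintegral_lt_top).ne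
  have hfin' : ∫⁻ z, ENNReal.ofReal (-g z) ∂μ ≠ ⊤ := (hg.neg.lintegral_lt_top).ne
  have h1 := lintegral_mono_ae hle
  rw [lintegral_add_left' hpos, lintegral_add_right' _ hneg] at h1
  rw [integral_eq_lintegral_pos_part_sub_lintegral_neg_part hg, sub_nonneg,
    ENNReal.toReal_le_toReal hfin' hfin] at h0
  refine (ENNReal.add_le_add_iff_left hfin).1 (h1.trans ?_)
  rw [add_comm]
  gcongr

section Measurability

variable {n : ℕ} {s : ℝ} {p : Rn n → Rn n → ℝ}

theorem measurable_energyDensity (hp : Measurable fun z : Rn n × Rn n => p z.1 z.2)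
    {w : Rn n → ℝ} (hw : Measurable w) :
    Measurable fun z : Rn n × Rn n =>
      |w z.1 - w z.2| ^ p z.1 z.2 / ‖z.1 - z.2‖ ^ ((n : ℝ) + s * p z.1 z.2) := by
  fun_prop

theorem measurable_coerciveNum (hp : Measurable fun z : Rn n × Rn n => p z.1 z.2)
    {v u : Rn n → ℝ} (hv : Measurable v) (hu : Measurable u) {B : Set (Rn n)}
    (hB : MeasurableSet B) :
    Measurable fun z : Rn n × Rn n => coerciveNum p v u B z.1 z.2 := by
  have hφ := measurable_testFn hv hu
  unfold coerciveNum
  refine Measurable.ite ?_ (by fun_prop) measurable_const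
  exact (measurableSet_lt measurable_const (hφ.comp measurable_fst)).inter
    ((measurable_snd hB).inter (measurableSet_eq_fun (hφ.comp measurable_snd) measurable_const))

theorem measurable_defectNum (hp : Measurable fun z : Rn n × Rn n => p z.1 z.2) {PM : ℝ}
    {v u : Rn n → ℝ} (hv : Measurable v) (hu : Measurable u) {B : Set (Rn n)}
    (hB : MeasurableSet B) :
    Measurable fun z : Rn n × Rn n => defectNum p PM v u B z.1 z.2 := by
  have hφ := measurable_testFn hv hu
  unfold defectNum
  refine Measurable.ite (measurableSet_lt measurable_const (hφ.comp measurable_fst)) ?_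
    measurable_const
  refine measurable_const.mul (Measurable.add (by fun_prop) ?_)
  exact Measurable.ite (measurable_snd hB) measurable_const (by fun_prop)

end Measurability

section Energy

variable {n : ℕ} {s : ℝ} {p : Rn n → Rn n → ℝ} {PM : ℝ}

theorem MemW.lintegral_prod_lt_top {u : Rn n → ℝ} (hu : MemW s p u)
    (hp : Measurable fun z : Rn n × Rn n => p z.1 z.2) :
    ∫⁻ z : Rn n × Rn n, ENNReal.ofReal
      (|u z.1 - u z.2| ^ p z.1 z.2 / ‖z.1 - z.2‖ ^ ((n : ℝ) + s * p z.1 z.2)) < ⊤ := by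
  rw [Measure.volume_eq_prod,
    lintegral_prod _ (measurable_energyDensity hp hu.1).ennreal_ofReal.aemeasurable]
  exact hu.2.2

theorem integrable_weakForm (hp : Measurable fun z : Rn n × Rn n => p z.1 z.2)
    (hp1 : ∀ x y, 1 < p x y) {u φ : Rn n → ℝ} (hu : MemW s p u) (hφ : MemW s p φ) :
    Integrable fun z : Rn n × Rn n =>
      |u z.1 - u z.2| ^ (p z.1 z.2 - 2) * (u z.1 - u z.2) * (φ z.1 - φ z.2)
        / ‖z.1 - z.2‖ ^ ((n : ℝ) + s * p z.1 z.2) := by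
  have hum := hu.1
  have hφm := hφ.1
  have hmeas : Measurable fun z : Rn n × Rn n =>
      |u z.1 - u z.2| ^ (p z.1 z.2 - 2) * (u z.1 - u z.2) * (φ z.1 - φ z.2)
        / ‖z.1 - z.2‖ ^ ((n : ℝ) + s * p z.1 z.2) := by fun_prop
  have hdom : ∀ {w : Rn n → ℝ}, MemW s p w → Integrable fun z : Rn n × Rn n =>
      |w z.1 - w z.2| ^ p z.1 z.2 / ‖z.1 - z.2‖ ^ ((n : ℝ) + s * p z.1 z.2) := by
    intro w hw
    refine ⟨(measurable_energyDensity hp hw.1).aestronglyMeasurable, ?_⟩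
    rw [hasFiniteIntegral_iff_ofReal (Eventually.of_forall fun z => by positivity)]
    exact hw.lintegral_prod_lt_top hp
  refine ((hdom hu).add (hdom hφ)).mono' hmeas.aestronglyMeasurable
    (Eventually.of_forall fun z => ?_)
  rw [Real.norm_eq_abs, abs_div, abs_of_nonneg (Real.rpow_nonneg (norm_nonneg (z.1 - z.2)) _),
    Pi.add_apply, ← add_div]
  gcongr
  exact abs_signedPow_mul (hp1 _ _)

theorem lintegral_coerciveNum_le (hp : Measurable fun z : Rn n × Rn n => p z.1 z.2)
    (hps : ∀ x y, p x y = p y x) (hp1 : ∀ x y, 1 < p x y) (hpM : ∀ x y, p x y ≤ PM)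
    {B : Set (Rn n)} (hB : MeasurableSet B) {v u : Rn n → ℝ} (hv : Measurable v)
    (hv0 : ∀ x, 0 ≤ v x) (hvB : ∀ x, x ∉ B → v x = 0) (hu : MemW s p u)
    (hφ : MemW s p (testFn v u)) (hsup : IsWeakSupersol s p B u)
    (huB : ∀ᵐ x, x ∈ B → 0 ≤ u x) :
    ∫⁻ x, ∫⁻ y, ENNReal.ofReal
        (coerciveNum p v u B x y / ‖x - y‖ ^ ((n : ℝ) + s * p x y))
      ≤ 2 * ∫⁻ x, ∫⁻ y, ENNReal.ofReal
        (defectNum p PM v u B x y / ‖x - y‖ ^ ((n : ℝ) + s * p x y)) := by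
  have hint := integrable_weakForm hp hp1 hu hφ
  have h0 := hsup _ hφ testFn_nonneg (Eventually.of_forall fun x hx =>
    le_antisymm ((testFn_le hv0 x).trans (hvB x hx).le) (testFn_nonneg x))
  rw [Measure.volume_eq_prod] at hint
  rw [← integral_prod (fun z : Rn n × Rn n =>
      |u z.1 - u z.2| ^ (p z.1 z.2 - 2) * (u z.1 - u z.2) * (testFn v u z.1 - testFn v u z.2)
        / ‖z.1 - z.2‖ ^ ((n : ℝ) + s * p z.1 z.2)) hint] at h0
  have hK : Measurable fun z : Rn n × Rn n => ‖z.1 - z.2‖ ^ ((n : ℝ) + s * p z.1 z.2) := by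
    fun_prop
  have hdm : Measurable fun z : Rn n × Rn n => ENNReal.ofReal
      (defectNum p PM v u B z.1 z.2 / ‖z.1 - z.2‖ ^ ((n : ℝ) + s * p z.1 z.2)) :=
    ((measurable_defectNum hp hv hu.1 hB).div hK).ennreal_ofReal
  have hcm : Measurable fun z : Rn n × Rn n => ENNReal.ofReal
      (coerciveNum p v u B z.1 z.2 / ‖z.1 - z.2‖ ^ ((n : ℝ) + s * p z.1 z.2)) :=
    ((measurable_coerciveNum hp hv hu.1 hB).div hK).ennreal_ofReal
  have key := lintegral_le_lintegral_of_integral_nonneg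
    (f := fun z : Rn n × Rn n => ENNReal.ofReal
      (coerciveNum p v u B z.1 z.2 / ‖z.1 - z.2‖ ^ ((n : ℝ) + s * p z.1 z.2)))
    (h := fun z : Rn n × Rn n => ENNReal.ofReal
      (defectNum p PM v u B z.1 z.2 / ‖z.1 - z.2‖ ^ ((n : ℝ) + s * p z.1 z.2))
      + ENNReal.ofReal
      (defectNum p PM v u B z.2 z.1 / ‖z.2 - z.1‖ ^ ((n : ℝ) + s * p z.2 z.1))) hint h0 (by
    filter_upwards [Measure.quasiMeasurePreserving_fst.ae huB,
      Measure.quasiMeasurePreserving_snd.ae huB] with z hz1 hz2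
    have hle := energy_add_coerciveNum_le (hp1 z.1 z.2) (hpM z.1 z.2) (hps _ _) hv0 hvB hz1 hz2
    have hK0 : 0 ≤ ‖z.1 - z.2‖ ^ ((n : ℝ) + s * p z.1 z.2) := by positivity
    rw [norm_sub_rev z.2 z.1, hps z.2 z.1]
    have hle' := div_le_div_of_nonneg_right hle hK0
    rw [add_div, add_div] at hle'
    have hc0 := div_nonneg (coerciveNum_nonneg (p := p) (v := v) (u := u) (B := B) z.1 z.2) hK0
    have hd1 := div_nonneg (defectNum_nonneg (p := p) (PM := PM) (v := v) (u := u) (B := B) z.1 z.2)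
      hK0
    have hd2 := div_nonneg (defectNum_nonneg (p := p) (PM := PM) (v := v) (u := u) (B := B) z.2 z.1)
      hK0
    rw [← ENNReal.ofReal_add hd1 hd2]
    rcases le_total 0 (|u z.1 - u z.2| ^ (p z.1 z.2 - 2) * (u z.1 - u z.2)
        * (testFn v u z.1 - testFn v u z.2) / ‖z.1 - z.2‖ ^ ((n : ℝ) + s * p z.1 z.2)) with hg | hg
    · rw [← ENNReal.ofReal_add hg hc0]
      exact (ENNReal.ofReal_le_ofReal hle').trans le_self_add
    · rw [ENNReal.ofReal_of_nonpos hg, zero_add,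
        ← ENNReal.ofReal_add (by positivity) (neg_nonneg.2 hg)]
      exact ENNReal.ofReal_le_ofReal (by linarith))
  have hswap := lintegral_prod_symm' (μ := (volume : Measure (Rn n)))
    (ν := (volume : Measure (Rn n))) (fun z : Rn n × Rn n => ENNReal.ofReal
      (defectNum p PM v u B z.2 z.1 / ‖z.2 - z.1‖ ^ ((n : ℝ) + s * p z.2 z.1)))
    (hdm.comp measurable_swap)
  rw [lintegral_prod _ hcm.aemeasurable, lintegral_add_left hdm, lintegral_prod _ hdm.aemeasurable,
    hswap] at key
  rw [two_mul]
  exact key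

end Energy

theorem add_rpow_le_two_rpow_mul {a b q : ℝ} (ha : 0 ≤ a) (hb : 0 ≤ b) (hq : 0 ≤ q) :
    (a + b) ^ q ≤ 2 ^ q * (a ^ q + b ^ q) := by
  have h1 : (a + b) ^ q ≤ (2 * max a b) ^ q :=
    Real.rpow_le_rpow (by positivity) (by linarith [le_max_left a b, le_max_right a b]) hq
  rw [Real.mul_rpow (by norm_num) (le_max_of_le_left ha)] at h1
  refine h1.trans (mul_le_mul_of_nonneg_left ?_ (by positivity))
  have := Real.rpow_nonneg ha q
  have := Real.rpow_nonneg hb q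
  rcases max_choice a b with h | h <;> rw [h] <;> linarith

section Estimates

variable {n : ℕ} {s : ℝ} {p : Rn n → Rn n → ℝ} {PM : ℝ} {x₀ : Rn n} {R ℓ c T Cκ : ℝ}

theorem lintegral_tent_density_le (hs0 : 0 < s) (hs1 : s < 1) (hp1 : ∀ x y, 1 < p x y)
    (hpM : ∀ x y, p x y ≤ PM) (hR : 0 < R) (hℓ : 0 < ℓ) (hc : 0 ≤ c) (hT0 : 0 ≤ T)
    (hκ : ∀ x : Rn n,
      ∫⁻ y, ENNReal.ofReal (R ^ (-(n : ℝ)) * decayProfile n s (‖x - y‖ / R)) ≤ ENNReal.ofReal Cκ)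
    {x : Rn n} (hT : ∀ y, (ℓ / R ^ s) ^ p x y ≤ T) :
    ∫⁻ y, ENNReal.ofReal (|tent x₀ R ℓ c x - tent x₀ R ℓ c y| ^ p x y
      / ‖x - y‖ ^ ((n : ℝ) + s * p x y)) ≤ ENNReal.ofReal (8 ^ PM * T * Cκ) := by
  have hE : 0 ≤ 8 ^ PM * T := by positivity
  calc ∫⁻ y, ENNReal.ofReal (|tent x₀ R ℓ c x - tent x₀ R ℓ c y| ^ p x y
      / ‖x - y‖ ^ ((n : ℝ) + s * p x y))
      ≤ ∫⁻ y, ENNReal.ofReal (8 ^ PM * T)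
        * ENNReal.ofReal (R ^ (-(n : ℝ)) * decayProfile n s (‖x - y‖ / R)) := by
        refine lintegral_mono fun y => ?_
        rw [← ENNReal.ofReal_mul hE]
        exact ENNReal.ofReal_le_ofReal (energyDensity_le_decayProfile hs0 hs1 (hp1 x y) (hpM x y)
          hR hℓ (hT y) (norm_nonneg _) (abs_tent_sub_le hR hℓ hc x y))
    _ = ENNReal.ofReal (8 ^ PM * T)
        * ∫⁻ y, ENNReal.ofReal (R ^ (-(n : ℝ)) * decayProfile n s (‖x - y‖ / R)) :=
        lintegral_const_mul' _ _ ENNReal.ofReal_ne_top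
    _ ≤ ENNReal.ofReal (8 ^ PM * T) * ENNReal.ofReal Cκ := by gcongr; exact hκ x
    _ = ENNReal.ofReal (8 ^ PM * T * Cκ) := (ENNReal.ofReal_mul hE).symm

theorem memW_tent (hs0 : 0 < s) (hs1 : s < 1)
    (hp : Measurable fun z : Rn n × Rn n => p z.1 z.2) (hps : ∀ x y, p x y = p y x)
    (hp1 : ∀ x y, 1 < p x y) (hpM : ∀ x y, p x y ≤ PM) (hR : 0 < R) (hℓ : 0 < ℓ) (hc : 0 ≤ c)
    (hT0 : 0 ≤ T)
    (hκ : ∀ x : Rn n,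
      ∫⁻ y, ENNReal.ofReal (R ^ (-(n : ℝ)) * decayProfile n s (‖x - y‖ / R)) ≤ ENNReal.ofReal Cκ)
    (hT : ∀ x ∈ ball x₀ (R / 2), ∀ y, (ℓ / R ^ s) ^ p x y ≤ T) :
    MemW s p (tent x₀ R ℓ c) := by
  have hvm : Measurable (tent x₀ R ℓ c) := continuous_tent.measurable
  refine ⟨hvm, ?_, ?_⟩
  · calc ∫⁻ x, ENNReal.ofReal (|tent x₀ R ℓ c x| ^ p x x)
        ≤ ∫⁻ x, (ball x₀ (R / 2)).indicator
            (fun _ => ENNReal.ofReal (max 1 (4 * ℓ) ^ PM)) x := by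
          refine lintegral_mono fun x => ?_
          by_cases hx : x ∈ ball x₀ (R / 2)
          · rw [indicator_of_mem hx]
            refine ENNReal.ofReal_le_ofReal ?_
            rw [abs_of_nonneg (tent_nonneg x)]
            exact (Real.rpow_le_rpow (tent_nonneg x)
              ((tent_le hR hℓ hc x).trans (le_max_right 1 _)) (by linarith [hp1 x x])).trans
              (Real.rpow_le_rpow_of_exponent_le (le_max_left _ _) (hpM x x))
          · rw [indicator_of_notMem hx, tent_eq_zero hR hℓ hc hx, abs_zero,
              Real.zero_rpow (by linarith [hp1 x x]), ENNReal.ofReal_zero]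
      _ = ENNReal.ofReal (max 1 (4 * ℓ) ^ PM) * volume (ball x₀ (R / 2)) :=
          lintegral_indicator_const measurableSet_ball _
      _ < ⊤ := ENNReal.mul_lt_top ENNReal.ofReal_lt_top measure_ball_lt_top
  · set F : Rn n → Rn n → ℝ≥0∞ := fun x y => ENNReal.ofReal
      (|tent x₀ R ℓ c x - tent x₀ R ℓ c y| ^ p x y / ‖x - y‖ ^ ((n : ℝ) + s * p x y)) with hF
    have hFm : Measurable fun z : Rn n × Rn n => F z.1 z.2 :=
      (measurable_energyDensity hp hvm).ennreal_ofReal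
    have hFs : ∀ x y, F x y = F y x := fun x y => by
      simp only [hF, abs_sub_comm (tent x₀ R ℓ c x), norm_sub_rev x y, hps x y]
    set G : Rn n → Rn n → ℝ≥0∞ := fun x y => (ball x₀ (R / 2)).indicator (fun x => F x y) x with hG
    have hGm : Measurable fun z : Rn n × Rn n => G z.1 z.2 := by
      have : (fun z : Rn n × Rn n => G z.1 z.2)
          = (Prod.fst ⁻¹' ball x₀ (R / 2)).indicator fun z => F z.1 z.2 := by
        ext z
        by_cases hz : z.1 ∈ ball x₀ (R / 2)
        · rw [indicator_of_mem (by exact hz)]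
          exact indicator_of_mem hz _
        · rw [indicator_of_notMem (by exact hz)]
          exact indicator_of_notMem hz _
      rw [this]
      exact hFm.indicator (measurable_fst measurableSet_ball)
    have hGlt : ∫⁻ x, ∫⁻ y, G x y < ⊤ := by
      calc ∫⁻ x, ∫⁻ y, G x y
          ≤ ∫⁻ x, (ball x₀ (R / 2)).indicator
            (fun _ => ENNReal.ofReal (8 ^ PM * T * Cκ)) x := by
            refine lintegral_mono fun x => ?_
            by_cases hx : x ∈ ball x₀ (R / 2)
            · simp only [hG, indicator_of_mem hx]
              exact lintegral_tent_density_le hs0 hs1 hp1 hpM hR hℓ hc hT0 hκ (hT x hx)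
            · simp only [hG, indicator_of_notMem hx, lintegral_zero, le_refl]
        _ = ENNReal.ofReal (8 ^ PM * T * Cκ) * volume (ball x₀ (R / 2)) :=
            lintegral_indicator_const measurableSet_ball _
        _ < ⊤ := ENNReal.mul_lt_top ENNReal.ofReal_lt_top measure_ball_lt_top
    have hle : ∀ x y, F x y ≤ G x y + G y x := by
      intro x y
      by_cases hx : x ∈ ball x₀ (R / 2)
      · simp only [hG, indicator_of_mem hx]
        exact le_self_add
      by_cases hy : y ∈ ball x₀ (R / 2)
      · simp only [hG, indicator_of_mem hy]
        rw [hFs x y]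
        exact le_add_self
      · have : F x y = 0 := by
          simp only [hF, tent_eq_zero hR hℓ hc hx, tent_eq_zero hR hℓ hc hy, sub_zero, abs_zero,
            Real.zero_rpow (by linarith [hp1 x y] : p x y ≠ 0), zero_div, ENNReal.ofReal_zero]
        rw [this]
        exact zero_le
    calc ∫⁻ x, ∫⁻ y, F x y ≤ ∫⁻ x, ∫⁻ y, (G x y + G y x) :=
          lintegral_mono fun x => lintegral_mono fun y => hle x y
      _ = (∫⁻ x, ∫⁻ y, G x y) + ∫⁻ x, ∫⁻ y, G y x := by
          rw [← lintegral_add_left hGm.lintegral_prod_right']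
          refine lintegral_congr fun x => ?_
          exact lintegral_add_left (hGm.comp measurable_prodMk_left) _
      _ = (∫⁻ x, ∫⁻ y, G x y) + ∫⁻ x, ∫⁻ y, G x y := by
          rw [lintegral_lintegral_swap (f := fun x y => G y x)
            (hGm.comp measurable_swap).aemeasurable]
      _ < ⊤ := ENNReal.add_lt_top.2 ⟨hGlt, hGlt⟩

theorem MemW.testFn (hp : Measurable fun z : Rn n × Rn n => p z.1 z.2)
    (hp1 : ∀ x y, 1 < p x y) (hpM : ∀ x y, p x y ≤ PM) {v u : Rn n → ℝ}
    (hv0 : ∀ x, 0 ≤ v x) (hv : MemW s p v) (hu : MemW s p u) : MemW s p (testFn v u) := by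
  refine ⟨measurable_testFn hv.1 hu.1, lt_of_le_of_lt (lintegral_mono fun x => ?_) hv.2.1, ?_⟩
  · refine ENNReal.ofReal_le_ofReal (Real.rpow_le_rpow (abs_nonneg _) ?_ (by linarith [hp1 x x]))
    rw [abs_of_nonneg (testFn_nonneg x), abs_of_nonneg (hv0 x)]
    exact testFn_le hv0 x
  · set D : (Rn n → ℝ) → Rn n × Rn n → ℝ≥0∞ := fun w z => ENNReal.ofReal
      (|w z.1 - w z.2| ^ p z.1 z.2 / ‖z.1 - z.2‖ ^ ((n : ℝ) + s * p z.1 z.2)) with hD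
    have hDm : ∀ {w : Rn n → ℝ}, Measurable w → Measurable (D w) := fun hw =>
      (measurable_energyDensity hp hw).ennreal_ofReal
    have hφm := hDm (measurable_testFn hv.1 hu.1)
    have hle : ∀ z, D (_root_.testFn v u) z ≤ ENNReal.ofReal (2 ^ PM) * (D v z + D u z) := by
      intro z
      simp only [hD]
      rw [← ENNReal.ofReal_add (by positivity) (by positivity),
        ← ENNReal.ofReal_mul (by positivity), ← add_div, ← mul_div_assoc]
      refine ENNReal.ofReal_le_ofReal ?_
      gcongr
      refine (Real.rpow_le_rpow (abs_nonneg _) (abs_testFn_sub_le _ _)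
        (by linarith [hp1 z.1 z.2])).trans
        ((add_rpow_le_two_rpow_mul (abs_nonneg _) (abs_nonneg _)
          (by linarith [hp1 z.1 z.2])).trans ?_)
      have : (2:ℝ) ^ p z.1 z.2 ≤ 2 ^ PM :=
        Real.rpow_le_rpow_of_exponent_le (by norm_num) (hpM _ _)
      gcongr
    have hprod : ∫⁻ z, D (_root_.testFn v u) z < ⊤ := by
      refine (lintegral_mono hle).trans_lt ?_
      rw [lintegral_const_mul' _ _ ENNReal.ofReal_ne_top, lintegral_add_left (hDm hv.1)]
      exact ENNReal.mul_lt_top ENNReal.ofReal_lt_top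
        (ENNReal.add_lt_top.2 ⟨hv.lintegral_prod_lt_top hp, hu.lintegral_prod_lt_top hp⟩)
    rw [Measure.volume_eq_prod, lintegral_prod _ hφm.aemeasurable] at hprod
    exact hprod

theorem lintegral_tail_le (hs0 : 0 < s) (hs1 : s < 1)
    (hp1 : ∀ x y, 1 < p x y) (hpM : ∀ x y, p x y ≤ PM) (hR : 0 < R) (hℓ : 0 < ℓ)
    {u : Rn n → ℝ} {x : Rn n} (hx : x ∈ ball x₀ (R / 2)) {f : ℝ}
    (hf : f ≤ 4 * ℓ)
    (htail : ∫⁻ y in (ball x₀ R)ᶜ, ENNReal.ofReal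
        ((max (-u y) 0) ^ (p x y - 1) / ‖y - x₀‖ ^ ((n : ℝ) + s * p x y))
      ≤ ENNReal.ofReal (2 * T / ℓ)) :
    ∫⁻ y in (ball x₀ R)ᶜ, ENNReal.ofReal
        ((max (-u y) 0) ^ (p x y - 1) * f / ‖x - y‖ ^ ((n : ℝ) + s * p x y))
      ≤ ENNReal.ofReal (8 * 2 ^ (n + PM) * T) := by
  have hE : 0 ≤ 4 * ℓ * (2:ℝ) ^ (n + PM) := by positivity
  calc ∫⁻ y in (ball x₀ R)ᶜ, ENNReal.ofReal
        ((max (-u y) 0) ^ (p x y - 1) * f / ‖x - y‖ ^ ((n : ℝ) + s * p x y))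
      ≤ ∫⁻ y in (ball x₀ R)ᶜ, ENNReal.ofReal (4 * ℓ * 2 ^ (n + PM)) * ENNReal.ofReal
        ((max (-u y) 0) ^ (p x y - 1) / ‖y - x₀‖ ^ ((n : ℝ) + s * p x y)) := by
        refine setLIntegral_mono' measurableSet_ball.compl fun y hy => ?_
        rw [← ENNReal.ofReal_mul hE]
        refine ENNReal.ofReal_le_ofReal ?_
        rw [mem_compl_iff, mem_ball, dist_eq_norm, not_lt] at hy
        rw [mem_ball, dist_eq_norm] at hx
        have hd : ‖y - x₀‖ ≤ 2 * ‖x - y‖ := by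
          have := norm_sub_le_norm_sub_add_norm_sub y x x₀
          rw [norm_sub_rev y x] at this
          linarith
        have hd0 : 0 < ‖y - x₀‖ := hR.trans_le hy
        have hd1 : 0 < ‖x - y‖ := by linarith
        have hq := hp1 x y
        have he : (0:ℝ) ≤ (n : ℝ) + s * p x y := by positivity
        have hK : ‖y - x₀‖ ^ ((n : ℝ) + s * p x y)
            ≤ 2 ^ (n + PM) * ‖x - y‖ ^ ((n : ℝ) + s * p x y) := by
          refine (Real.rpow_le_rpow hd0.le hd he).trans ?_
          rw [Real.mul_rpow (by norm_num) hd1.le]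
          have : (2:ℝ) ^ ((n : ℝ) + s * p x y) ≤ 2 ^ (n + PM) :=
            Real.rpow_le_rpow_of_exponent_le (by norm_num) (by nlinarith [hpM x y])
          gcongr
        have hm : 0 ≤ max (-u y) 0 ^ (p x y - 1) := Real.rpow_nonneg (le_max_right _ _) _
        rw [← mul_div_assoc, div_le_div_iff₀ (by positivity) (by positivity)]
        calc max (-u y) 0 ^ (p x y - 1) * f * ‖y - x₀‖ ^ ((n : ℝ) + s * p x y)
            ≤ max (-u y) 0 ^ (p x y - 1) * (4 * ℓ)
              * (2 ^ (n + PM) * ‖x - y‖ ^ ((n : ℝ) + s * p x y)) := by gcongr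
          _ = _ := by ring
    _ = ENNReal.ofReal (4 * ℓ * 2 ^ (n + PM)) * ∫⁻ y in (ball x₀ R)ᶜ, ENNReal.ofReal
        ((max (-u y) 0) ^ (p x y - 1) / ‖y - x₀‖ ^ ((n : ℝ) + s * p x y)) :=
        lintegral_const_mul' _ _ ENNReal.ofReal_ne_top
    _ ≤ ENNReal.ofReal (4 * ℓ * 2 ^ (n + PM)) * ENNReal.ofReal (2 * T / ℓ) := by gcongr
    _ = ENNReal.ofReal (8 * 2 ^ (n + PM) * T) := by
        rw [← ENNReal.ofReal_mul hE]
        congr 1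
        field_simp
        ring

theorem ofReal_defectNum_div_eq {v u : Rn n → ℝ} {B : Set (Rn n)} {x : Rn n}
    (hφ : 0 < testFn v u x) (y : Rn n) :
    ENNReal.ofReal (defectNum p PM v u B x y / ‖x - y‖ ^ ((n : ℝ) + s * p x y))
      = ENNReal.ofReal (2 * 2 ^ PM) * (ENNReal.ofReal (|v x - v y| ^ p x y
          / ‖x - y‖ ^ ((n : ℝ) + s * p x y))
        + Bᶜ.indicator (fun y => ENNReal.ofReal
        ((max (-u y) 0) ^ (p x y - 1) * testFn v u x / ‖x - y‖ ^ ((n : ℝ) + s * p x y))) y) := by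
  have hE : (0:ℝ) ≤ 2 * 2 ^ PM := by positivity
  have hK : 0 ≤ ‖x - y‖ ^ ((n : ℝ) + s * p x y) := Real.rpow_nonneg (norm_nonneg _) _
  have h1 : 0 ≤ |v x - v y| ^ p x y / ‖x - y‖ ^ ((n : ℝ) + s * p x y) :=
    div_nonneg (Real.rpow_nonneg (abs_nonneg _) _) hK
  have h2 : 0 ≤ max (-u y) 0 ^ (p x y - 1) * testFn v u x / ‖x - y‖ ^ ((n : ℝ) + s * p x y) :=
    div_nonneg (mul_nonneg (Real.rpow_nonneg (le_max_right _ _) _) hφ.le) hK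
  rw [defectNum, if_pos hφ]
  by_cases hy : y ∈ B
  · rw [if_pos hy, indicator_of_notMem (by simpa using hy), add_zero, add_zero,
      ← ENNReal.ofReal_mul hE, mul_div_assoc]
  · rw [if_neg hy, indicator_of_mem hy, ← ENNReal.ofReal_add h1 h2,
      ← ENNReal.ofReal_mul hE, mul_div_assoc, add_div]

theorem lintegral_defectNum_slice_le (hp : Measurable fun z : Rn n × Rn n => p z.1 z.2)
    {v u : Rn n → ℝ} (hv : Measurable v) {B : Set (Rn n)} (hB : MeasurableSet B) {x : Rn n}
    (hφ : 0 < testFn v u x) {a b : ℝ} (ha : 0 ≤ a) (hb : 0 ≤ b)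
    (h1 : ∫⁻ y, ENNReal.ofReal (|v x - v y| ^ p x y / ‖x - y‖ ^ ((n : ℝ) + s * p x y))
      ≤ ENNReal.ofReal a)
    (h2 : ∫⁻ y in Bᶜ, ENNReal.ofReal
        ((max (-u y) 0) ^ (p x y - 1) * testFn v u x / ‖x - y‖ ^ ((n : ℝ) + s * p x y))
      ≤ ENNReal.ofReal b) :
    ∫⁻ y, ENNReal.ofReal (defectNum p PM v u B x y / ‖x - y‖ ^ ((n : ℝ) + s * p x y))
      ≤ ENNReal.ofReal (2 * 2 ^ PM * (a + b)) := by
  have hm1 : Measurable fun y => ENNReal.ofReal (|v x - v y| ^ p x y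
          / ‖x - y‖ ^ ((n : ℝ) + s * p x y)) := by
    have hpx : Measurable fun y => p x y :=
      hp.comp (g := fun z : Rn n × Rn n => p z.1 z.2) measurable_prodMk_left
    fun_prop
  rw [lintegral_congr (ofReal_defectNum_div_eq (B := B) (PM := PM) (s := s) (p := p) hφ),
    lintegral_const_mul' _ _ ENNReal.ofReal_ne_top, lintegral_add_left hm1,
    lintegral_indicator hB.compl,
    ENNReal.ofReal_mul (by positivity : (0:ℝ) ≤ 2 * 2 ^ PM), ENNReal.ofReal_add ha hb]
  gcongr

theorem lintegral_defectNum_le (hs0 : 0 < s) (hs1 : s < 1)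
    (hp : Measurable fun z : Rn n × Rn n => p z.1 z.2)
    (hp1 : ∀ x y, 1 < p x y) (hpM : ∀ x y, p x y ≤ PM) (hR : 0 < R) (hℓ : 0 < ℓ) (hc : 0 ≤ c)
    (hT0 : 0 ≤ T) (hCκ : 0 ≤ Cκ)
    (hκ : ∀ x : Rn n,
      ∫⁻ y, ENNReal.ofReal (R ^ (-(n : ℝ)) * decayProfile n s (‖x - y‖ / R)) ≤ ENNReal.ofReal Cκ)
    (hT : ∀ x ∈ ball x₀ (R / 2), ∀ y, (ℓ / R ^ s) ^ p x y ≤ T)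
    {u : Rn n → ℝ} (hu : Measurable u)
    (htail : ∀ x ∈ ball x₀ (R / 2), ∫⁻ y in (ball x₀ R)ᶜ, ENNReal.ofReal
        ((max (-u y) 0) ^ (p x y - 1) / ‖y - x₀‖ ^ ((n : ℝ) + s * p x y))
      ≤ ENNReal.ofReal (2 * T / ℓ)) :
    ∫⁻ x, ∫⁻ y, ENNReal.ofReal (defectNum p PM (tent x₀ R ℓ c) u (ball x₀ R) x y
        / ‖x - y‖ ^ ((n : ℝ) + s * p x y))
      ≤ ENNReal.ofReal (2 * 2 ^ PM * (8 ^ PM * Cκ + 8 * 2 ^ (n + PM)) * T)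
        * volume {x | 0 < testFn (tent x₀ R ℓ c) u x} := by
  have hvm : Measurable (tent x₀ R ℓ c) := continuous_tent.measurable
  have hA : MeasurableSet {x | 0 < testFn (tent x₀ R ℓ c) u x} :=
    measurableSet_lt measurable_const (measurable_testFn hvm hu)
  rw [← lintegral_indicator_const hA]
  refine lintegral_mono fun x => ?_
  by_cases hφ : 0 < testFn (tent x₀ R ℓ c) u x
  · rw [indicator_of_mem (show x ∈ {x | 0 < testFn (tent x₀ R ℓ c) u x} from hφ)]
    have hx : x ∈ ball x₀ (R / 2) := by
      by_contra h
      have h1 := testFn_le (u := u) (v := tent x₀ R ℓ c) (fun x => tent_nonneg x) x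
      rw [tent_eq_zero hR hℓ hc h] at h1
      exact absurd hφ (not_lt.2 h1)
    have h1 := lintegral_tent_density_le (x₀ := x₀) hs0 hs1 hp1 hpM hR hℓ hc hT0 hκ (hT x hx)
    have h2 := lintegral_tail_le hs0 hs1 hp1 hpM hR hℓ hx
      ((testFn_le (u := u) (v := tent x₀ R ℓ c) (fun x => tent_nonneg x) x).trans
        (tent_le hR hℓ hc x)) (htail x hx)
    refine (lintegral_defectNum_slice_le hp hvm measurableSet_ball hφ (by positivity)
      (by positivity) h1 h2).trans (ENNReal.ofReal_le_ofReal (le_of_eq ?_))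
    ring
  · have h0 : ∀ y, defectNum p PM (tent x₀ R ℓ c) u (ball x₀ R) x y = 0 := fun y => by
      rw [defectNum, if_neg hφ]
    simp only [h0, zero_div, ENNReal.ofReal_zero, lintegral_zero, zero_le]

/-- The energy inequality for truncations below a cone. -/
theorem lintegral_coerciveNum_tent_le (hs0 : 0 < s) (hs1 : s < 1)
    (hp : Measurable fun z : Rn n × Rn n => p z.1 z.2) (hps : ∀ x y, p x y = p y x)
    (hp1 : ∀ x y, 1 < p x y) (hpM : ∀ x y, p x y ≤ PM) (hR : 0 < R) (hℓ : 0 < ℓ) (hc : 0 ≤ c)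
    (hT0 : 0 ≤ T) (hCκ : 0 ≤ Cκ)
    (hκ : ∀ x : Rn n,
      ∫⁻ y, ENNReal.ofReal (R ^ (-(n : ℝ)) * decayProfile n s (‖x - y‖ / R)) ≤ ENNReal.ofReal Cκ)
    (hT : ∀ x ∈ ball x₀ (R / 2), ∀ y, (ℓ / R ^ s) ^ p x y ≤ T)
    {u : Rn n → ℝ} (hu : MemW s p u) (hsup : IsWeakSupersol s p (ball x₀ R) u)
    (huB : ∀ᵐ x, x ∈ ball x₀ R → 0 ≤ u x)
    (htail : ∀ x ∈ ball x₀ (R / 2), ∫⁻ y in (ball x₀ R)ᶜ, ENNReal.ofReal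
        ((max (-u y) 0) ^ (p x y - 1) / ‖y - x₀‖ ^ ((n : ℝ) + s * p x y))
      ≤ ENNReal.ofReal (2 * T / ℓ)) :
    ∫⁻ x, ∫⁻ y, ENNReal.ofReal (coerciveNum p (tent x₀ R ℓ c) u (ball x₀ R) x y
        / ‖x - y‖ ^ ((n : ℝ) + s * p x y))
      ≤ ENNReal.ofReal (4 * 2 ^ PM * (8 ^ PM * Cκ + 8 * 2 ^ (n + PM)) * T)
        * volume {x | 0 < testFn (tent x₀ R ℓ c) u x} := by
  have hv := memW_tent (x₀ := x₀) (c := c) hs0 hs1 hp hps hp1 hpM hR hℓ hc hT0 hκ hT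
  refine (lintegral_coerciveNum_le hp hps hp1 hpM measurableSet_ball hv.1 (fun x => tent_nonneg x)
    (fun x hx => tent_eq_zero hR hℓ hc fun h => hx (ball_subset_ball (by linarith) h)) hu
    (hv.testFn hp hp1 hpM (fun x => tent_nonneg x) hu) hsup huB).trans ?_
  refine (mul_le_mul_right
    (lintegral_defectNum_le hs0 hs1 hp hp1 hpM hR hℓ hc hT0 hCκ hκ hT hu.1 htail) _).trans ?_
  rw [← mul_assoc]
  refine mul_le_mul_left (le_of_eq ?_) _
  rw [show (2 : ℝ≥0∞) = ENNReal.ofReal 2 by simp, ← ENNReal.ofReal_mul (by norm_num)]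
  congr 1
  ring

end Estimates

theorem mul_measureReal_le_of_lintegral_le {n : ℕ} {F : Rn n → Rn n → ℝ} {E : Set (Rn n)}
    {S : Rn n → Set (Rn n)} {κ ρ M : ℝ} (hE : MeasurableSet E)
    (hS : ∀ x ∈ E, MeasurableSet (S x)) (hκ0 : 0 ≤ κ) (hρ0 : 0 ≤ ρ) (hM : 0 ≤ M)
    (hκ : ∀ x ∈ E, ∀ y ∈ S x, κ ≤ F x y) (hρ : ∀ x ∈ E, ρ ≤ volume.real (S x))
    (h : ∫⁻ x, ∫⁻ y, ENNReal.ofReal (F x y) ≤ ENNReal.ofReal M) :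
    κ * ρ * volume.real E ≤ M := by
  have h1 : ENNReal.ofReal (κ * ρ) * volume E ≤ ENNReal.ofReal M := by
    refine le_trans ?_ h
    rw [← lintegral_indicator_const hE]
    refine lintegral_mono fun x => ?_
    by_cases hx : x ∈ E
    · rw [indicator_of_mem hx, ENNReal.ofReal_mul hκ0]
      calc ENNReal.ofReal κ * ENNReal.ofReal ρ ≤ ENNReal.ofReal κ * volume (S x) := by
            gcongr
            exact (ENNReal.ofReal_le_ofReal (hρ x hx)).trans ENNReal.ofReal_toReal_le
        _ = ∫⁻ y, (S x).indicator (fun _ => ENNReal.ofReal κ) y :=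
            (lintegral_indicator_const (hS x hx) _).symm
        _ ≤ ∫⁻ y, ENNReal.ofReal (F x y) := by
            refine lintegral_mono fun y => ?_
            by_cases hy : y ∈ S x
            · rw [indicator_of_mem hy]
              exact ENNReal.ofReal_le_ofReal (hκ x hx y hy)
            · rw [indicator_of_notMem hy]
              exact zero_le
    · rw [indicator_of_notMem hx]
      exact zero_le
  have h2 := ENNReal.toReal_mono ENNReal.ofReal_ne_top h1
  rwa [ENNReal.toReal_mul, ENNReal.toReal_ofReal (by positivity), ENNReal.toReal_ofReal hM] at h2

theorem volume_real_ball_Rn {n : ℕ} (x : Rn n) {r : ℝ} (hr : 0 < r) :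
    volume.real (ball x r) = r ^ n * volume.real (ball (0 : Rn n) 1) := by
  rw [Measure.real, Measure.real, Measure.addHaar_ball_of_pos _ _ hr, ENNReal.toReal_mul,
    ENNReal.toReal_ofReal (by positivity), finrank_euclideanSpace_fin]

/-- The set where `u₊` lies strictly below the truncated cone. -/
def belowTent {n : ℕ} (x₀ : Rn n) (R ℓ c : ℝ) (u : Rn n → ℝ) : Set (Rn n) :=
  {x | 0 < testFn (tent x₀ R ℓ c) u x}

section BelowTent

variable {n : ℕ} {s : ℝ} {p : Rn n → Rn n → ℝ} {Pm PM : ℝ} {x₀ : Rn n} {R ℓ c d h r T L C δ γ : ℝ}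
  {u : Rn n → ℝ}

theorem measurableSet_belowTent (hu : Measurable u) : MeasurableSet (belowTent x₀ R ℓ c u) :=
  measurableSet_lt measurable_const (measurable_testFn continuous_tent.measurable hu)

theorem belowTent_subset_ball (hR : 0 < R) (hℓ : 0 < ℓ) (hc : 0 ≤ c) :
    belowTent x₀ R ℓ c u ⊆ ball x₀ (R / 2) := by
  intro x hx
  by_contra h
  have h1 := testFn_le (u := u) (v := tent x₀ R ℓ c) (fun x => tent_nonneg x) x
  rw [tent_eq_zero hR hℓ hc h] at h1
  exact absurd hx (not_lt.2 h1)

theorem max_lt_of_mem_belowTent {x : Rn n} (hx : x ∈ belowTent x₀ R ℓ c u) :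
    max (u x) 0 < 4 * ℓ * (1 - 2 * (‖x - x₀‖ / R)) - c := by
  have h : 0 < max (tent x₀ R ℓ c x - max (u x) 0) 0 := hx
  have h0 : 0 ≤ max (u x) 0 := le_max_right _ _
  rcases lt_max_iff.1 h with h | h
  · have h1 : 0 < max (4 * ℓ * (1 - 2 * (‖x - x₀‖ / R)) - c) 0 - max (u x) 0 := h
    rcases max_choice (4 * ℓ * (1 - 2 * (‖x - x₀‖ / R)) - c) 0 with h2 | h2 <;> rw [h2] at h1 <;>
      linarith
  · exact absurd h (lt_irrefl _)

theorem lt_testFn_of_mem_belowTent {x : Rn n} (hx : x ∈ belowTent x₀ R ℓ (c + d) u) :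
    d < testFn (tent x₀ R ℓ c) u x := by
  have h1 := max_lt_of_mem_belowTent hx
  have h2 : 4 * ℓ * (1 - 2 * (‖x - x₀‖ / R)) - c ≤ tent x₀ R ℓ c x := le_max_left _ _
  have h3 : tent x₀ R ℓ c x - max (u x) 0 ≤ testFn (tent x₀ R ℓ c) u x := le_max_left _ _
  linarith

theorem belowTent_anti (hcd : c ≤ d) : belowTent x₀ R ℓ d u ⊆ belowTent x₀ R ℓ c u := by
  intro x hx
  have := lt_testFn_of_mem_belowTent (c := c) (d := d - c) (x := x) (u := u)
    (by rwa [add_sub_cancel])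
  exact (sub_nonneg.2 hcd).trans_lt this

theorem volume_belowTent_ne_top (hR : 0 < R) (hℓ : 0 < ℓ) (hc : 0 ≤ c) :
    volume (belowTent x₀ R ℓ c u) ≠ ⊤ :=
  measure_ne_top_of_subset (belowTent_subset_ball hR hℓ hc) measure_ball_lt_top.ne

theorem measureReal_belowTent_anti (hR : 0 < R) (hℓ : 0 < ℓ) (hc : 0 ≤ c) (hcd : c ≤ d) :
    volume.real (belowTent x₀ R ℓ d u) ≤ volume.real (belowTent x₀ R ℓ c u) :=
  measureReal_mono (belowTent_anti hcd) (volume_belowTent_ne_top hR hℓ hc)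

/-- The energy bound in terms of the measure of `belowTent`. -/
def EnergyBound (s : ℝ) (p : Rn n → Rn n → ℝ) (x₀ : Rn n) (R ℓ : ℝ) (u : Rn n → ℝ) (M : ℝ) : Prop :=
  ∀ c, 0 ≤ c → ∫⁻ x, ∫⁻ y, ENNReal.ofReal (coerciveNum p (tent x₀ R ℓ c) u (ball x₀ R) x y
        / ‖x - y‖ ^ ((n : ℝ) + s * p x y))
      ≤ ENNReal.ofReal (M * volume.real (belowTent x₀ R ℓ c u))

theorem coerciveNum_div_ge_of_le {x y : Rn n} {f g D : ℝ} {v : Rn n → ℝ} {B : Set (Rn n)}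
    (hs0 : 0 < s) (hp1 : 1 < p x y) (hpM : p x y ≤ PM) (hf : 0 < f) (hg : 0 ≤ g)
    (hfx : f ≤ testFn v u x) (hgx : g ≤ max (testFn v u x) (u y - u x)) (hyB : y ∈ B)
    (hy : testFn v u y = 0) (hxy : ‖x - y‖ ≤ D) :
    2 ^ (-PM) * (f * g ^ (p x y - 1)) / D ^ ((n : ℝ) + s * p x y)
      ≤ coerciveNum p v u B x y / ‖x - y‖ ^ ((n : ℝ) + s * p x y) := by
  have hφ := hf.trans_le hfx
  have hne : 0 < ‖x - y‖ := by
    rw [norm_pos_iff, sub_ne_zero]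
    rintro rfl
    rw [hy] at hφ
    exact lt_irrefl _ hφ
  rw [coerciveNum, if_pos ⟨hφ, hyB, hy⟩]
  have h2 : (2:ℝ) ^ (-PM) ≤ 2 ^ (-p x y) :=
    Real.rpow_le_rpow_of_exponent_le (by norm_num) (by linarith)
  have he : (0:ℝ) ≤ (n : ℝ) + s * p x y := by positivity
  rw [mul_assoc]
  have hg1 : g ^ (p x y - 1) ≤ max (testFn v u x) (u y - u x) ^ (p x y - 1) :=
    Real.rpow_le_rpow hg hgx (by linarith)
  have hg2 := Real.rpow_nonneg hg (p x y - 1)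
  gcongr

theorem measureReal_belowTent_add_le (hs0 : 0 < s) (hp1 : ∀ x y, 1 < p x y)
    (hpM : ∀ x y, p x y ≤ PM) (hu : Measurable u) (hR : 0 < R) (hℓ : 0 < ℓ) (hc : 0 ≤ c)
    (hh : h ∈ Ioo (0:ℝ) 1) (hr : 0 < r) (hrR : r ≤ R / 2) (hT : 0 < T) (hL : 0 < L) (hC : 0 ≤ C)
    (hTL : ∀ x ∈ ball x₀ R, ∀ y ∈ ball x₀ R, T / (2 * L) ≤ (ℓ / R ^ s) ^ p x y)
    (hen : EnergyBound s p x₀ R ℓ u (C * T))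
    (hsmall : volume.real (belowTent x₀ R ℓ c u) ≤ r ^ n * volume.real (ball (0 : Rn n) 1) / 2) :
    volume.real (belowTent x₀ R ℓ (c + h * ℓ) u)
      ≤ 2 * L * C * 2 ^ PM * (h ^ (-PM) * (r / R) ^ s * r ^ n) := by
  set V := volume.real (ball (0 : Rn n) 1) with hV
  have hV0 : 0 < V := ENNReal.toReal_pos (measure_ball_pos _ _ one_pos).ne' measure_ball_lt_top.ne
  set κ := 2 ^ (-PM) * h ^ PM * (T / (2 * L)) * (R / r) ^ s / r ^ n with hκ
  have hh0 := hh.1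
  have hκ0 : 0 < κ := by positivity
  have hrn : (0:ℝ) < r ^ n := by positivity
  have key : κ * (r ^ n * V / 2) * volume.real (belowTent x₀ R ℓ (c + h * ℓ) u)
      ≤ C * T * volume.real (belowTent x₀ R ℓ c u) := by
    refine mul_measureReal_le_of_lintegral_le (S := fun x => ball x r \ belowTent x₀ R ℓ c u)
      (measurableSet_belowTent hu)
      (fun x _ => measurableSet_ball.diff (measurableSet_belowTent hu)) hκ0.le (by positivity)
      (by positivity) (fun x hx y hy => ?_) (fun x _ => ?_) (hen c hc)
    · have hφx := lt_testFn_of_mem_belowTent hx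
      have hxB : x ∈ ball x₀ (R / 2) := belowTent_subset_ball hR hℓ (by positivity) hx
      have hyx : dist y x < r := hy.1
      have hyB : y ∈ ball x₀ R := by
        rw [mem_ball] at hxB ⊢
        linarith [dist_triangle y x x₀]
      have hφy : testFn (tent x₀ R ℓ c) u y = 0 :=
        le_antisymm (not_lt.1 hy.2) (testFn_nonneg y)
      have hhl : 0 < h * ℓ := by positivity
      refine le_trans ?_ (coerciveNum_div_ge_of_le (n := n) (PM := PM) (f := h * ℓ) (g := h * ℓ)
        (D := r) hs0 (hp1 x y) (hpM x y) hhl hhl.le hφx.le (le_max_of_le_left hφx.le) hyB hφy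
        (by rw [← dist_eq_norm, dist_comm]; exact hyx.le))
      have hq := hp1 x y
      have e1 : h * ℓ * (h * ℓ) ^ (p x y - 1) = (h * ℓ) ^ p x y := by
        rw [mul_comm, rpow_sub_one_mul_self hq hhl.le]
      have e2 : r ^ ((n : ℝ) + s * p x y) = r ^ n * (r ^ s) ^ p x y := by
        rw [Real.rpow_add hr, Real.rpow_natCast, Real.rpow_mul hr.le]
      have e3 : (h * ℓ) ^ p x y = h ^ p x y * (ℓ / R ^ s) ^ p x y * ((R / r) ^ s) ^ p x y
          * (r ^ s) ^ p x y := by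
        rw [← Real.mul_rpow, ← Real.mul_rpow, ← Real.mul_rpow, Real.div_rpow]
        · congr 1
          field_simp
        all_goals positivity
      rw [e1, e2, e3, hκ]
      have b1 : h ^ PM ≤ h ^ p x y := Real.rpow_le_rpow_of_exponent_ge hh.1 hh.2.le (hpM x y)
      have b2 := hTL x (ball_subset_ball (by linarith) hxB) y hyB
      have b3 : (R / r) ^ s ≤ ((R / r) ^ s) ^ p x y := by
        refine Real.self_le_rpow_of_one_le (Real.one_le_rpow ?_ hs0.le) hq.le
        rw [one_le_div hr]
        linarith
      rw [show (2:ℝ) ^ (-PM) * (h ^ p x y * (ℓ / R ^ s) ^ p x y * ((R / r) ^ s) ^ p x y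
          * (r ^ s) ^ p x y) / (r ^ n * (r ^ s) ^ p x y)
          = 2 ^ (-PM) * h ^ p x y * (ℓ / R ^ s) ^ p x y * ((R / r) ^ s) ^ p x y / r ^ n by
        have : 0 < (r ^ s) ^ p x y := by positivity
        field_simp]
      gcongr
    · have h1 : volume.real (ball x r) ≤ volume.real (ball x r \ belowTent x₀ R ℓ c u)
          + volume.real (belowTent x₀ R ℓ c u) :=
        (measureReal_mono (by rw [sdiff_union_self]; exact subset_union_left)
          (measure_union_ne_top (measure_ne_top_of_subset sdiff_subset measure_ball_lt_top.ne)
            (volume_belowTent_ne_top hR hℓ hc))).trans (measureReal_union_le _ _)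
      rw [volume_real_ball_Rn x hr] at h1
      linarith
  have key2 : κ * volume.real (belowTent x₀ R ℓ (c + h * ℓ) u) ≤ C * T := by
    have h3 : C * T * volume.real (belowTent x₀ R ℓ c u) ≤ C * T * (r ^ n * V / 2) := by gcongr
    have h4 : 0 < r ^ n * V / 2 := by positivity
    refine le_of_mul_le_mul_right ?_ h4
    linarith
  have e : 2 * L * C * 2 ^ PM * (h ^ (-PM) * (r / R) ^ s * r ^ n) = C * T / κ := by
    rw [hκ, Real.rpow_neg hh0.le, Real.rpow_neg (by norm_num), Real.div_rpow hr.le hR.le,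
      Real.div_rpow hR.le hr.le]
    have := Real.rpow_pos_of_pos hr s
    have := Real.rpow_pos_of_pos hR s
    have := Real.rpow_pos_of_pos hh0 PM
    field_simp
  rw [e, le_div_iff₀ hκ0]
  linarith

theorem measureReal_belowTent_half_le (hs0 : 0 < s) (hPm : ∀ x y, Pm ≤ p x y) (hPm1 : 1 < Pm)
    (hpM : ∀ x y, p x y ≤ PM) (hu : Measurable u) (hR : 0 < R) (hℓ : 0 < ℓ)
    (hδ : δ ∈ Ioc (0:ℝ) (1 / 8)) (hT : 0 < T) (hL : 0 < L) (hC : 0 ≤ C) (hγ : 0 < γ)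
    (hTL : ∀ x ∈ ball x₀ R, ∀ y ∈ ball x₀ R, T / (2 * L) ≤ (ℓ / R ^ s) ^ p x y)
    (hen : EnergyBound s p x₀ R ℓ u (C * T))
    (hbig : γ * volume.real (ball x₀ (R / 2))
      ≤ volume.real {x ∈ ball x₀ (R / 2) | ℓ / δ ≤ u x}) :
    volume.real (belowTent x₀ R ℓ (ℓ / 2) u)
      ≤ 2 * L * C * 4 ^ PM / γ * δ ^ (Pm - 1) * R ^ n := by
  set V := volume.real (ball x₀ (R / 2)) with hV
  have hV0 : 0 < V :=
    ENNReal.toReal_pos (measure_ball_pos _ _ (by positivity)).ne' measure_ball_lt_top.ne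
  have hδ0 := hδ.1
  set κ := 4 ^ (-PM) * (T / (2 * L)) * δ ^ (1 - Pm) / R ^ n with hκ
  have hκ0 : 0 < κ := by positivity
  have hH : 8 * ℓ ≤ ℓ / δ := by
    rw [le_div_iff₀ hδ0]
    nlinarith [hδ.2]
  have key : κ * (γ * V) * volume.real (belowTent x₀ R ℓ (ℓ / 2) u)
      ≤ C * T * volume.real (belowTent x₀ R ℓ 0 u) := by
    refine mul_measureReal_le_of_lintegral_le (S := fun _ => {x ∈ ball x₀ (R / 2) | ℓ / δ ≤ u x})
      (measurableSet_belowTent hu)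
      (fun x _ => measurableSet_ball.inter (measurableSet_le measurable_const hu)) hκ0.le
      (by positivity) (by positivity) (fun x hx y hy => ?_) (fun x _ => hbig) (hen 0 le_rfl)
    have hφx : ℓ / 2 < testFn (tent x₀ R ℓ 0) u x :=
      lt_testFn_of_mem_belowTent (by rwa [zero_add])
    have hxB : x ∈ ball x₀ (R / 2) := belowTent_subset_ball hR hℓ (by positivity) hx
    have hux : u x ≤ 4 * ℓ := by
      have h1 := max_lt_of_mem_belowTent hx
      have h2 : 0 ≤ ‖x - x₀‖ / R := by positivity
      have h3 := le_max_left (u x) 0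
      nlinarith
    obtain ⟨hyB, huy⟩ := hy
    have hφy : testFn (tent x₀ R ℓ 0) u y = 0 := by
      refine max_eq_right ?_
      have h1 := tent_le (x₀ := x₀) hR hℓ le_rfl y
      have h3 := le_max_left (u y) 0
      linarith
    have hxy : ‖x - y‖ ≤ R := by
      rw [← dist_eq_norm]
      rw [mem_ball] at hxB hyB
      linarith [dist_triangle_right x y x₀]
    have hq : 1 < p x y := hPm1.trans_le (hPm x y)
    refine le_trans ?_ (coerciveNum_div_ge_of_le (n := n) (PM := PM) (f := ℓ / 2)
      (g := ℓ / 2 / δ) (D := R) hs0 hq (hpM x y) (by positivity) (by positivity) hφx.le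
      (le_max_of_le_right ?_) (ball_subset_ball (by linarith) hyB) hφy hxy)
    · have e1 : ℓ / 2 * (ℓ / 2 / δ) ^ (p x y - 1)
          = 2 ^ (-p x y) * (ℓ / R ^ s) ^ p x y * δ ^ (1 - p x y) * (R ^ s) ^ p x y := by
        rw [Real.div_rpow (by positivity) hδ0.le, mul_div_assoc', mul_comm (ℓ / 2),
          rpow_sub_one_mul_self hq (by positivity), Real.div_rpow hℓ.le (by norm_num),
          Real.div_rpow hℓ.le (by positivity), Real.rpow_neg (by norm_num),
          show 1 - p x y = -(p x y - 1) by ring, Real.rpow_neg hδ0.le]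
        have : 0 < (R ^ s) ^ p x y := by positivity
        field_simp
      have e2 : R ^ ((n : ℝ) + s * p x y) = R ^ n * (R ^ s) ^ p x y := by
        rw [Real.rpow_add hR, Real.rpow_natCast, Real.rpow_mul hR.le]
      rw [e1, e2, hκ, show (2:ℝ) ^ (-PM) * (2 ^ (-p x y) * (ℓ / R ^ s) ^ p x y * δ ^ (1 - p x y)
          * (R ^ s) ^ p x y) / (R ^ n * (R ^ s) ^ p x y)
          = 2 ^ (-PM) * 2 ^ (-p x y) * (ℓ / R ^ s) ^ p x y * δ ^ (1 - p x y) / R ^ n by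
        have : 0 < (R ^ s) ^ p x y := by positivity
        field_simp]
      have b1 : (4:ℝ) ^ (-PM) ≤ 2 ^ (-PM) * 2 ^ (-p x y) := by
        rw [show (4:ℝ) = 2 * 2 by norm_num, Real.mul_rpow (by norm_num) (by norm_num)]
        gcongr
        · norm_num
        · exact hpM x y
      have b2 := hTL x (ball_subset_ball (by linarith) hxB) y (ball_subset_ball (by linarith) hyB)
      have b3 : δ ^ (1 - Pm) ≤ δ ^ (1 - p x y) :=
        Real.rpow_le_rpow_of_exponent_ge hδ0 (by linarith [hδ.2]) (by linarith [hPm x y])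
      gcongr
    · rw [div_right_comm]
      linarith
  have key2 : κ * γ * volume.real (belowTent x₀ R ℓ (ℓ / 2) u) ≤ C * T := by
    have h3 : C * T * volume.real (belowTent x₀ R ℓ 0 u) ≤ C * T * V := by
      gcongr
      exact measureReal_mono (belowTent_subset_ball hR hℓ le_rfl) measure_ball_lt_top.ne
    refine le_of_mul_le_mul_right ?_ hV0
    linarith
  have e : 2 * L * C * 4 ^ PM / γ * δ ^ (Pm - 1) * R ^ n = C * T / (κ * γ) := by
    rw [hκ, show 1 - Pm = -(Pm - 1) by ring, Real.rpow_neg hδ0.le, Real.rpow_neg (by norm_num)]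
    have := Real.rpow_pos_of_pos hδ0 (Pm - 1)
    field_simp
  rw [e, le_div_iff₀ (by positivity)]
  linarith

end BelowTent

/-- De Giorgi type iteration: geometric decay along radii shrinking by the factor `q`. -/
theorem nonpos_of_measure_decay {n : ℕ} (hn : 1 ≤ n) {s R ℓ V C PM q ε : ℝ} {a : ℝ → ℝ}
    (hR : 0 < R) (hℓ : 0 < ℓ)
    (hq : q ∈ Ioo (0:ℝ) 1) (hqs : q ^ s = 2 ^ (-PM)) (hε : ε ∈ Ioc (0:ℝ) (1 / 2))
    (hεs : C * 4 ^ PM * ε ^ s ≤ q ^ n * V / 2)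
    (hanti : ∀ c d, 0 ≤ c → c ≤ d → a d ≤ a c)
    (hstep : ∀ c h r, 0 ≤ c → h ∈ Ioo (0:ℝ) 1 → 0 < r → r ≤ R / 2 → a c ≤ r ^ n * V / 2 →
      a (c + h * ℓ) ≤ C * (h ^ (-PM) * (r / R) ^ s * r ^ n))
    (hbase : a (ℓ / 2) ≤ (R * ε) ^ n * V / 2) : a ℓ ≤ 0 := by
  have hq0 := hq.1
  have hε0 := hε.1
  have hk : ∀ k : ℕ, a (ℓ * (1 - 2⁻¹ ^ (k + 1))) ≤ (R * ε * q ^ k) ^ n * V / 2 := by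
    intro k
    induction k with
    | zero =>
      have : ℓ * (1 - 2⁻¹ ^ (0 + 1)) = ℓ / 2 := by ring
      rw [this, pow_zero, mul_one]
      exact hbase
    | succ k ih =>
      have hc : 0 ≤ ℓ * (1 - 2⁻¹ ^ (k + 1)) := by
        have : (2⁻¹:ℝ) ^ (k + 1) ≤ 1 := pow_le_one₀ (by norm_num) (by norm_num)
        nlinarith
      have hr : R * ε * q ^ k ≤ R / 2 := by
        have h1 : q ^ k ≤ 1 := pow_le_one₀ hq0.le hq.2.le
        have h2 : R * ε ≤ R / 2 := by nlinarith [hε.2]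
        have h3 : 0 < R * ε := by positivity
        nlinarith
      have h1 := hstep _ (2⁻¹ ^ (k + 2)) (R * ε * q ^ k) hc
        ⟨by positivity, pow_lt_one₀ (by norm_num) (by norm_num) (by omega)⟩ (by positivity) hr ih
      have e1 : ℓ * (1 - 2⁻¹ ^ (k + 1)) + 2⁻¹ ^ (k + 2) * ℓ = ℓ * (1 - 2⁻¹ ^ (k + 1 + 1)) := by
        ring
      have e2 : ((2⁻¹:ℝ) ^ (k + 2)) ^ (-PM) * (R * ε * q ^ k / R) ^ s = 4 ^ PM * ε ^ s := by
        rw [mul_assoc R, mul_div_cancel_left₀ _ hR.ne', Real.mul_rpow hε0.le (by positivity),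
          ← Real.rpow_natCast q, ← Real.rpow_mul hq0.le, mul_comm (k : ℝ) s, Real.rpow_mul hq0.le,
          hqs, ← Real.rpow_natCast, Real.inv_rpow (by norm_num), ← Real.rpow_neg (by norm_num),
          ← Real.rpow_mul (by norm_num), ← Real.rpow_mul (by norm_num),
          show (4:ℝ) = 2 ^ (2:ℝ) by norm_num, ← Real.rpow_mul (by norm_num), mul_left_comm,
          ← Real.rpow_add (by norm_num), mul_comm (ε ^ s)]
        congr 2
        push_cast
        ring
      rw [e1, e2] at h1
      refine h1.trans ?_
      calc C * (4 ^ PM * ε ^ s * (R * ε * q ^ k) ^ n)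
          = C * 4 ^ PM * ε ^ s * (R * ε * q ^ k) ^ n := by ring
        _ ≤ q ^ n * V / 2 * (R * ε * q ^ k) ^ n := by gcongr
        _ = (R * ε * q ^ (k + 1)) ^ n * V / 2 := by ring
  have hlim : Tendsto (fun k : ℕ => (R * ε * q ^ k) ^ n * V / 2) atTop (𝓝 0) := by
    have h1 := ((((tendsto_pow_atTop_nhds_zero_of_lt_one hq0.le hq.2).const_mul (R * ε)).pow
      n).mul_const V).div_const 2
    simpa [show n ≠ 0 by omega] using h1
  refine ge_of_tendsto' hlim fun k => ?_
  refine (hanti _ _ ?_ ?_).trans (hk k)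
  · have : (2⁻¹:ℝ) ^ (k + 1) ≤ 1 := pow_le_one₀ (by norm_num) (by norm_num)
    nlinarith
  · have : 0 < (2⁻¹:ℝ) ^ (k + 1) := by positivity
    nlinarith

section Exponent

variable {n : ℕ} {p : Rn n → Rn n → ℝ} {Pm PM : ℝ} {E F E' F' : Set (Rn n)}

theorem le_pSup (hpM : ∀ x y, p x y ≤ PM) {x y : Rn n} (hx : x ∈ E) (hy : y ∈ F) :
    p x y ≤ pSup p E F :=
  le_csSup ⟨PM, by rintro _ ⟨a, _, b, _, rfl⟩; exact hpM a b⟩ (mem_image2_of_mem hx hy)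

theorem pInf_le (hPm : ∀ x y, Pm ≤ p x y) {x y : Rn n} (hx : x ∈ E) (hy : y ∈ F) :
    pInf p E F ≤ p x y :=
  csInf_le ⟨Pm, by rintro _ ⟨a, _, b, _, rfl⟩; exact hPm a b⟩ (mem_image2_of_mem hx hy)

theorem pSup_mono (hpM : ∀ x y, p x y ≤ PM) (hE : E.Nonempty) (hF : F.Nonempty) (hEE : E ⊆ E')
    (hFF : F ⊆ F') : pSup p E F ≤ pSup p E' F' :=
  csSup_le (hE.image2 hF) (by
    rintro _ ⟨a, ha, b, hb, rfl⟩
    exact le_pSup hpM (hEE ha) (hFF hb))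

theorem pInf_le_pSup (hp : ∀ x y, Pm ≤ p x y ∧ p x y ≤ PM) (hE : E.Nonempty) (hF : F.Nonempty) :
    pInf p E F ≤ pSup p E F := by
  obtain ⟨x, hx⟩ := hE
  obtain ⟨y, hy⟩ := hF
  exact (pInf_le (fun x y => (hp x y).1) hx hy).trans (le_pSup (fun x y => (hp x y).2) hx hy)

/-- Condition (P1) in a ball extends to the ball itself. -/
theorem CondP1.rpow_le {L R : ℝ} {x₀ : Rn n} (hp : ∀ x y, Pm ≤ p x y ∧ p x y ≤ PM)
    (hR : R ∈ Ioo (0:ℝ) 1) (h : CondP1 p (ball x₀ R) L) :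
    R ^ (pInf p (ball x₀ R) (ball x₀ R) - pSup p (ball x₀ R) (ball x₀ R)) ≤ L := by
  have hR0 := hR.1
  have hne : (ball x₀ R).Nonempty := nonempty_ball.2 hR0
  have hlim : Tendsto (fun ε : ℝ => R ^ (pInf p (ball x₀ R) (ball x₀ R) + ε
      - (pSup p (ball x₀ R) (ball x₀ R) - ε))) (𝓝[>] 0)
      (𝓝 (R ^ (pInf p (ball x₀ R) (ball x₀ R) - pSup p (ball x₀ R) (ball x₀ R)))) := by
    have hc : Continuous fun ε : ℝ => R ^ (pInf p (ball x₀ R) (ball x₀ R) + ε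
        - (pSup p (ball x₀ R) (ball x₀ R) - ε)) :=
      Continuous.rpow continuous_const (by fun_prop) fun _ => Or.inl hR0.ne'
    have := (hc.tendsto 0).mono_left (nhdsWithin_le_nhds (s := Ioi 0))
    simpa using this
  refine le_of_tendsto hlim (eventually_nhdsWithin_of_forall fun ε (hε : 0 < ε) => ?_)
  obtain ⟨_, ⟨x₁, hx₁, y₁, hy₁, rfl⟩, h₁⟩ := exists_lt_of_lt_csSup (hne.image2 hne)
    (show pSup p (ball x₀ R) (ball x₀ R) - ε < sSup (image2 p (ball x₀ R) (ball x₀ R)) from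
      sub_lt_self _ hε)
  obtain ⟨_, ⟨x₂, hx₂, y₂, hy₂, rfl⟩, h₂⟩ := exists_lt_of_csInf_lt (hne.image2 hne)
    (show sInf (image2 p (ball x₀ R) (ball x₀ R)) < pInf p (ball x₀ R) (ball x₀ R) + ε from
      lt_add_of_pos_right _ hε)
  obtain ⟨r, hr, hrR⟩ : ∃ r, max (max (dist x₁ x₀) (dist y₁ x₀)) (max (dist x₂ x₀) (dist y₂ x₀)) < r
      ∧ r < R := exists_between (max_lt (max_lt hx₁ hy₁) (max_lt hx₂ hy₂))
  obtain ⟨hr₁, hr₂⟩ := max_lt_iff.1 hr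
  obtain ⟨hx₁', hy₁'⟩ := max_lt_iff.1 hr₁
  obtain ⟨hx₂', hy₂'⟩ := max_lt_iff.1 hr₂
  have hr0 : 0 < r := dist_nonneg.trans_lt hx₁'
  have hP := h x₀ r hr0 (closedBall_subset_ball hrR)
  have hs := le_pSup (E := ball x₀ r) (F := ball x₀ r) (fun x y => (hp x y).2) hx₁' hy₁'
  have hi := pInf_le (E := ball x₀ r) (F := ball x₀ r) (fun x y => (hp x y).1) hx₂' hy₂'
  have hne' : (ball x₀ r).Nonempty := nonempty_ball.2 hr0
  have his := pInf_le_pSup hp hne' hne'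
  calc R ^ (pInf p (ball x₀ R) (ball x₀ R) + ε - (pSup p (ball x₀ R) (ball x₀ R) - ε))
      ≤ R ^ (pInf p (ball x₀ r) (ball x₀ r) - pSup p (ball x₀ r) (ball x₀ r)) :=
        Real.rpow_le_rpow_of_exponent_ge hR0 hR.2.le (by linarith)
    _ ≤ r ^ (pInf p (ball x₀ r) (ball x₀ r) - pSup p (ball x₀ r) (ball x₀ r)) :=
        Real.rpow_le_rpow_of_nonpos hr0 hrR.le (by linarith)
    _ ≤ L := hP

theorem CondP2.le_pSup_ball {R : ℝ} {x₀ : Rn n} (hpM : ∀ x y, p x y ≤ PM) (hR : 0 < R)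
    (h : CondP2 p (ball x₀ R)) {x : Rn n} (hx : x ∈ ball x₀ (R / 2)) (y : Rn n) :
    p x y ≤ pSup p (ball x₀ R) (ball x₀ R) := by
  have hsub : ball x₀ (R / 2) ⊆ ball x₀ R := ball_subset_ball (by linarith)
  by_cases hy : y ∈ ball x₀ (R / 2)
  · exact le_pSup hpM (hsub hx) (hsub hy)
  · have hne : (ball x₀ (R / 2)).Nonempty := ⟨x, hx⟩
    exact (le_pSup hpM hx hy).trans
      ((h x₀ (R / 2) (by positivity) (closedBall_subset_ball (by linarith))).1.trans
        (pSup_mono hpM hne hne hsub hsub))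

end Exponent

theorem rpow_scale_le {s L R H δ a b : ℝ} (hs0 : 0 < s) (hs1 : s < 1) (hR : R ∈ Ioo (0:ℝ) 1)
    (hH : 0 < H) (hδ : δ ∈ Ioc (0:ℝ) (1 / 8)) (hab : a ≤ b) (hRL : R ^ (a - b) ≤ L)
    (hHab : H ^ (b - a) ≤ 2) :
    (δ * H / R ^ s) ^ b ≤ 2 * L * (δ * H / R ^ s) ^ a := by
  have hR0 := hR.1
  have hδ0 := hδ.1
  have h1 : 1 ≤ R ^ (a - b) := Real.one_le_rpow_of_pos_of_le_one_of_nonpos hR0 hR.2.le (by linarith)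
  have h2 : (δ * H / R ^ s) ^ (b - a) ≤ 2 * L := by
    calc (δ * H / R ^ s) ^ (b - a) = δ ^ (b - a) * H ^ (b - a) * (R ^ (a - b)) ^ s := by
          rw [Real.div_rpow (by positivity) (by positivity), Real.mul_rpow hδ0.le hH.le,
            ← Real.rpow_mul hR0.le, ← Real.rpow_mul hR0.le, div_eq_mul_inv, ← Real.rpow_neg hR0.le]
          congr 2
          ring
      _ ≤ 1 * 2 * L := by
          have h3 : δ ^ (b - a) ≤ 1 :=
            Real.rpow_le_one hδ0.le (by linarith [hδ.2]) (by linarith)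
          have h4 : (R ^ (a - b)) ^ s ≤ L :=
            ((Real.rpow_le_rpow_of_exponent_le h1 hs1.le).trans_eq (Real.rpow_one _)).trans hRL
          gcongr
      _ = 2 * L := by ring
  have h5 : 0 < δ * H / R ^ s := by positivity
  rw [show b = (b - a) + a by ring, Real.rpow_add h5]
  gcongr

theorem tail_scale_le {s R ℓ a b : ℝ} (hR : 0 < R) (hℓ : 0 < ℓ) (h1 : 1 ≤ ℓ / R ^ s)
    (hab : a ≤ b) :
    R ^ (-(s * b)) * ℓ ^ (b - 1) + R ^ (-(s * a)) * ℓ ^ (a - 1) ≤ 2 * (ℓ / R ^ s) ^ b / ℓ := by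
  have key : ∀ e : ℝ, R ^ (-(s * e)) * ℓ ^ (e - 1) = (ℓ / R ^ s) ^ e / ℓ := fun e => by
    rw [Real.div_rpow hℓ.le (by positivity), ← Real.rpow_mul hR.le, Real.rpow_neg hR.le,
      Real.rpow_sub_one hℓ.ne']
    ring
  rw [key, key, ← add_div]
  gcongr
  linarith [Real.rpow_le_rpow_of_exponent_le h1 hab]

theorem exists_mul_rpow_le {a b C η : ℝ} (ha : 0 < a) (hb : 0 < b) (hC : 0 ≤ C) (hη : 0 < η) :
    ∃ x ∈ Ioc 0 b, C * x ^ a ≤ η := by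
  have h0 : 0 < (η / (C + 1)) ^ a⁻¹ := by positivity
  refine ⟨min b ((η / (C + 1)) ^ a⁻¹), ⟨lt_min hb h0, min_le_left _ _⟩, ?_⟩
  have h1 : min b ((η / (C + 1)) ^ a⁻¹) ^ a ≤ η / (C + 1) :=
    (Real.rpow_le_rpow (lt_min hb h0).le (min_le_right _ _) ha.le).trans_eq
      (Real.rpow_inv_rpow (by positivity) ha.ne')
  calc C * min b ((η / (C + 1)) ^ a⁻¹) ^ a ≤ (C + 1) * (η / (C + 1)) := by
        gcongr
        linarith
    _ = η := by field_simp

/-- the growth lemma (Lemma 5.2); `δ` depends only on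
`n, s, σ, γ, L` and the fixed bounds `Pm ≤ p ≤ PM` for the exponent. -/
theorem statement10 {n : ℕ} (hn : 1 ≤ n) (s σ γ L Pm PM : ℝ)
    (hσ : 0 < σ) (hσs : σ < s) (hs1 : s < 1)
    (hγ : γ ∈ Set.Ioo (0:ℝ) 1) (hL : 0 < L) (hPm : 1 < Pm) (hPmM : Pm ≤ PM) :
    ∃ δ : ℝ, δ ∈ Set.Ioc (0:ℝ) (1/8) ∧
    ∀ p : Rn n → Rn n → ℝ,
      Continuous (fun z : Rn n × Rn n => p z.1 z.2) →
      (∀ x y, p x y = p y x) →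
      (∀ x y, Pm ≤ p x y ∧ p x y ≤ PM) →
    ∀ (x₀ : Rn n) (R H : ℝ), R ∈ Set.Ioo (0:ℝ) 1 → 0 < H →
      CondP1 p (ball x₀ R) L → CondP2 p (ball x₀ R) →
      H ^ (pSup p (ball x₀ R) (ball x₀ R) - pInf p (ball x₀ R) (ball x₀ R)) ≤ 2 →
      pSup p (ball x₀ R) (ball x₀ R)
        < n * pInf p (ball x₀ R) (ball x₀ R) / (n - σ * pInf p (ball x₀ R) (ball x₀ R)) →
    ∀ u : Rn n → ℝ, MemW s p u → IsWeakSupersol s p (ball x₀ R) u →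
      (∀ᵐ x, x ∈ ball x₀ R → 0 ≤ u x ∧ u x ≤ 2 * H) →
      γ * (volume (ball x₀ (R / 2))).toReal
        ≤ (volume {x ∈ ball x₀ (R / 2) | H ≤ u x}).toReal →
      R ^ s ≤ δ * H →
      (∀ x ∈ ball x₀ (3 * R / 4),
        (∫⁻ y in (ball x₀ R)ᶜ,
            ENNReal.ofReal ((max (-u y) 0) ^ (p x y - 1) / ‖y - x₀‖ ^ ((n : ℝ) + s * p x y)))
          ≤ ENNReal.ofReal
              (R ^ (-(s * pSup p (ball x₀ R) (ball x₀ R)))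
                  * (δ * H) ^ (pSup p (ball x₀ R) (ball x₀ R) - 1)
                + R ^ (-(s * pInf p (ball x₀ R) (ball x₀ R)))
                  * (δ * H) ^ (pInf p (ball x₀ R) (ball x₀ R) - 1))) →
      ∀ᵐ x, x ∈ ball x₀ (R / 4) → δ * H ≤ u x := by
  have hs0 : 0 < s := hσ.trans hσs
  obtain ⟨Cκ, hCκ, hκ⟩ := exists_lintegral_decayProfile_le hn hs0 hs1
  set V := volume.real (ball (0 : Rn n) 1) with hV
  have hV0 : 0 < V := ENNReal.toReal_pos (measure_ball_pos _ _ one_pos).ne' measure_ball_lt_top.ne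
  set C := 4 * 2 ^ PM * (8 ^ PM * Cκ + 8 * 2 ^ (n + PM)) with hC
  have hC0 : 0 ≤ C := by positivity
  set q : ℝ := 2 ^ (-PM / s) with hq
  have hq0 : 0 < q := by positivity
  have hq1 : q < 1 := Real.rpow_lt_one_of_one_lt_of_neg (by norm_num)
    (div_neg_of_neg_of_pos (by linarith) hs0)
  have hqs : q ^ s = 2 ^ (-PM) := by
    rw [hq, ← Real.rpow_mul (by norm_num), div_mul_cancel₀ _ hs0.ne']
  obtain ⟨ε, hε, hεs⟩ := exists_mul_rpow_le (b := 1 / 2) (C := 2 * L * C * 2 ^ PM * 4 ^ PM)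
    (η := q ^ n * V / 2) hs0 (by norm_num) (by positivity) (by positivity)
  have hε0 := hε.1
  obtain ⟨δ, hδ, hδP⟩ := exists_mul_rpow_le (a := Pm - 1) (b := 1 / 8)
    (C := 2 * L * C * 4 ^ PM / γ) (η := ε ^ n * V / 2) (by linarith) (by norm_num)
    (div_nonneg (by positivity) hγ.1.le) (by positivity)
  refine ⟨δ, hδ, ?_⟩
  intro p hpc hps hp x₀ R H hR hH hP1 hP2 hHp _ u hu hsup huB hbig hRδ htail
  have hR0 := hR.1
  have hδ0 := hδ.1
  have hp1 : ∀ x y, 1 < p x y := fun x y => hPm.trans_le (hp x y).1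
  have hpM : ∀ x y, p x y ≤ PM := fun x y => (hp x y).2
  have hℓ : 0 < δ * H := mul_pos hδ0 hH
  have ht1 : 1 ≤ δ * H / R ^ s := (one_le_div (by positivity)).2 hRδ
  have hne : (ball x₀ R).Nonempty := nonempty_ball.2 hR0
  have hab := pInf_le_pSup hp hne hne
  have hscale := rpow_scale_le hs0 hs1 hR hH hδ hab (hP1.rpow_le hp hR) hHp
  set pS := pSup p (ball x₀ R) (ball x₀ R) with hpS
  set T := (δ * H / R ^ s) ^ pS with hTdef
  have hT0 : 0 < T := by positivity
  have hT : ∀ x ∈ ball x₀ (R / 2), ∀ y, (δ * H / R ^ s) ^ p x y ≤ T := fun x hx y =>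
    Real.rpow_le_rpow_of_exponent_le ht1 (hP2.le_pSup_ball hpM hR0 hx y)
  have hTL : ∀ x ∈ ball x₀ R, ∀ y ∈ ball x₀ R, T / (2 * L) ≤ (δ * H / R ^ s) ^ p x y := by
    intro x hx y hy
    rw [div_le_iff₀' (by positivity)]
    refine hscale.trans ?_
    have := Real.rpow_le_rpow_of_exponent_le ht1 (pInf_le (fun x y => (hp x y).1) hx hy)
    gcongr
  have hen : EnergyBound s p x₀ R (δ * H) u (C * T) := by
    intro c hc
    rw [ENNReal.ofReal_mul (by positivity), Measure.real,
      ENNReal.ofReal_toReal (volume_belowTent_ne_top hR0 hℓ hc)]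
    refine lintegral_coerciveNum_tent_le hs0 hs1 hpc.measurable hps hp1 hpM hR0 hℓ hc hT0.le hCκ
      (fun x => hκ R x hR0) hT hu hsup (huB.mono fun x h hx => (h hx).1) fun x hx => ?_
    exact (htail x (ball_subset_ball (by linarith) hx)).trans
      (ENNReal.ofReal_le_ofReal (tail_scale_le hR0 hℓ ht1 hab))
  have hbase : volume.real (belowTent x₀ R (δ * H) (δ * H / 2) u) ≤ (R * ε) ^ n * V / 2 := by
    refine (measureReal_belowTent_half_le (δ := δ) hs0 (fun x y => (hp x y).1) hPm hpM hu.1 hR0 hℓ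
      hδ hT0 hL hC0 hγ.1 hTL hen ?_).trans ?_
    · rw [mul_div_cancel_left₀ _ hδ0.ne']
      exact hbig
    · calc 2 * L * C * 4 ^ PM / γ * δ ^ (Pm - 1) * R ^ n ≤ ε ^ n * V / 2 * R ^ n := by gcongr
        _ = (R * ε) ^ n * V / 2 := by ring
  have hzero : volume.real (belowTent x₀ R (δ * H) (δ * H) u) ≤ 0 :=
    nonpos_of_measure_decay (a := fun c => volume.real (belowTent x₀ R (δ * H) c u)) hn hR0 hℓ
      ⟨hq0, hq1⟩ hqs hε hεs (fun c d hc hcd => measureReal_belowTent_anti hR0 hℓ hc hcd)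
      (fun c h r hc hh hr hrR hsmall => measureReal_belowTent_add_le hs0 hp1 hpM hu.1 hR0 hℓ hc hh
        hr hrR hT0 hL hC0 hTL hen hsmall) hbase
  have hnull : volume (belowTent x₀ R (δ * H) (δ * H) u) = 0 :=
    (measureReal_eq_zero_iff (volume_belowTent_ne_top hR0 hℓ hℓ.le)).1
      (le_antisymm hzero measureReal_nonneg)
  filter_upwards [huB, measure_eq_zero_iff_ae_notMem.1 hnull] with x hxB hx hx4
  by_contra! hlt
  refine hx ?_
  have hux := (hxB (ball_subset_ball (by linarith) hx4)).1
  have hd : ‖x - x₀‖ / R < 1 / 4 := by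
    rw [mem_ball, dist_eq_norm] at hx4
    rw [div_lt_iff₀ hR0]
    linarith
  have htent : δ * H ≤ tent x₀ R (δ * H) (δ * H) x := by
    refine le_trans ?_ (le_max_left _ _)
    nlinarith
  show 0 < max (tent x₀ R (δ * H) (δ * H) x - max (u x) 0) 0
  rw [max_eq_left hux]
  exact lt_max_of_lt_left (by linarith)
end
end

section
/- Let ω : [0,∞) → [0,∞) be bounded, concave, nondecreasing, and differentiable on (0,∞), and define p : ℝ × ℝ → ℝ by p(x,y) = |x|·ω(|y|). Then p satisfies (P1) in the interval (−1,1): there exists L > 0 such that for every x₀ ∈ ℝ and R > 0 with [x₀−R, x₀+R] ⊆ (−1,1), one has R^{p₋(B×B) − p₊(B×B)} ≤ L, where B = (x₀−R, x₀+R), p₊(B×B) = sup_{x,y∈B} p(x,y), and p₋(B×B) = inf_{x,y∈B} p(x,y). -/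
open MeasureTheory Metric Set Filter
open scoped ENNReal Topology
noncomputable section

/-- A nonnegative concave function on `[0, ∞)` lies above its chords from the origin. -/
theorem mul_le_mul_of_concaveOn_Ici {ω : ℝ → ℝ} (h0 : 0 ≤ ω 0)
    (hconc : ConcaveOn ℝ (Set.Ici 0) ω) {a b : ℝ} (ha : 0 ≤ a) (hab : a < b) :
    a * ω b ≤ b * ω a := by
  have hb : 0 < b := ha.trans_lt hab
  have h := hconc.2 (Set.mem_Ici.2 hb.le) (Set.mem_Ici.2 le_rfl)
    (div_nonneg ha hb.le) (sub_nonneg.2 ((div_le_one hb).2 hab.le)) (by ring)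
  simp only [smul_eq_mul, mul_zero, add_zero, div_mul_cancel₀ a hb.ne'] at h
  have h1 : 0 ≤ (1 - a / b) * ω 0 := mul_nonneg (sub_nonneg.2 ((div_le_one hb).2 hab.le)) h0
  have h2 : a / b * ω b ≤ ω a := by linarith
  calc a * ω b = b * (a / b * ω b) := by field_simp
    _ ≤ b * ω a := mul_le_mul_of_nonneg_left h2 hb.le

/-- The oscillation of `(a, b) ↦ a * ω b` is linear in the mutual distance `d` of the arguments. -/
theorem mul_sub_mul_le_of_concaveOn_Ici {ω : ℝ → ℝ} {M : ℝ} (hnn : ∀ r : ℝ, 0 ≤ r → 0 ≤ ω r)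
    (hM : ∀ r : ℝ, 0 ≤ r → ω r ≤ M) (hconc : ConcaveOn ℝ (Set.Ici 0) ω)
    (hmono : MonotoneOn ω (Set.Ici 0)) {a b a' b' d : ℝ} (ha' : 0 ≤ a') (hb : 0 ≤ b)
    (hb' : 0 ≤ b') (hd : 0 ≤ d) (haa : a ≤ a' + d) (hbb : b ≤ b' + d) (hab : a' ≤ b' + d) :
    a * ω b - a' * ω b' ≤ 3 * M * d := by
  have hM0 : 0 ≤ M := (hnn 0 le_rfl).trans (hM 0 le_rfl)
  have hdM : 0 ≤ d * M := mul_nonneg hd hM0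
  have h1 : (a - a') * ω b ≤ d * M :=
    mul_le_mul (by linarith) (hM b hb) (hnn b hb) hd
  have h2 : a' * (ω b - ω b') ≤ 2 * (d * M) := by
    rcases le_or_gt b b' with h | h
    · have := mul_nonneg ha' (sub_nonneg.2 (hmono hb hb' h))
      linarith
    · have h3 := mul_le_mul_of_concaveOn_Ici (hnn 0 le_rfl) hconc hb' h
      have h4 : (b - b') * ω b' ≤ d * M :=
        mul_le_mul (by linarith) (hM b' hb') (hnn b' hb') hd
      have h5 : d * (ω b - ω b') ≤ d * M :=
        mul_le_mul_of_nonneg_left (by linarith [hM b hb, hnn b' hb']) hd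
      have h6 := mul_le_mul_of_nonneg_right hab (sub_nonneg.2 (hmono hb' hb h.le))
      linarith
  linarith

/-- `R ^ (-(C * R))` is bounded by `exp C` for positive `R`. -/
theorem rpow_neg_mul_self_le_exp {C R : ℝ} (hC : 0 ≤ C) (hR : 0 < R) :
    R ^ (-(C * R)) ≤ Real.exp C := by
  rw [Real.rpow_def_of_pos hR, Real.exp_le_exp]
  have h := Real.one_sub_inv_le_log_of_pos hR
  have h1 : R * (1 - R⁻¹) ≤ R * Real.log R := mul_le_mul_of_nonneg_left h hR.le
  have h2 : R * (1 - R⁻¹) = R - 1 := by field_simp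
  have h3 : C * (-(R * Real.log R)) ≤ C * 1 := mul_le_mul_of_nonneg_left (by linarith) hC
  linarith

/-- the exponent `p(x,y) = |x|·ω(|y|)` satisfies (P1) in `(-1,1)`. -/
theorem statement12 (ω : ℝ → ℝ)
    (hnn : ∀ r : ℝ, 0 ≤ r → 0 ≤ ω r)
    (hbd : ∃ M : ℝ, ∀ r : ℝ, 0 ≤ r → ω r ≤ M)
    (hconc : ConcaveOn ℝ (Set.Ici 0) ω)
    (hmono : MonotoneOn ω (Set.Ici 0))
    (hdiff : DifferentiableOn ℝ ω (Set.Ioi 0)) :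
    ∃ L > 0, ∀ x₀ R : ℝ, 0 < R → Set.Icc (x₀ - R) (x₀ + R) ⊆ Set.Ioo (-1 : ℝ) 1 →
      R ^ (sInf (Set.image2 (fun x y : ℝ => |x| * ω |y|)
              (Set.Ioo (x₀ - R) (x₀ + R)) (Set.Ioo (x₀ - R) (x₀ + R)))
          - sSup (Set.image2 (fun x y : ℝ => |x| * ω |y|)
              (Set.Ioo (x₀ - R) (x₀ + R)) (Set.Ioo (x₀ - R) (x₀ + R)))) ≤ L := by
  obtain ⟨M, hM⟩ := hbd
  have hM0 : 0 ≤ M := (hnn 0 le_rfl).trans (hM 0 le_rfl)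
  refine ⟨Real.exp (6 * M), Real.exp_pos _, fun x₀ R hR hsub => ?_⟩
  have hl := (hsub (Set.left_mem_Icc.2 (by linarith))).1
  have hr := (hsub (Set.right_mem_Icc.2 (by linarith))).2
  set B := Set.Ioo (x₀ - R) (x₀ + R) with hB
  set S := Set.image2 (fun x y : ℝ => |x| * ω |y|) B B with hS
  have hne : S.Nonempty := by
    have hx : x₀ ∈ B := ⟨by linarith, by linarith⟩
    exact ⟨_, Set.mem_image2_of_mem hx hx⟩
  have hdist : ∀ u ∈ B, ∀ v ∈ B, |u| ≤ |v| + 2 * R := fun u hu v hv => by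
    have h1 : |u - v| ≤ 2 * R :=
      abs_le.2 ⟨by linarith [hu.1, hv.2], by linarith [hu.2, hv.1]⟩
    linarith [abs_sub_abs_le_abs_sub u v]
  have hosc : sSup S - 6 * M * R ≤ sInf S := by
    refine le_csInf hne ?_
    rintro _ ⟨x', hx', y', hy', rfl⟩
    refine sub_le_iff_le_add.2 (csSup_le hne ?_)
    rintro _ ⟨x, hx, y, hy, rfl⟩
    have := mul_sub_mul_le_of_concaveOn_Ici hnn hM hconc hmono (abs_nonneg x') (abs_nonneg y)
      (abs_nonneg y') (by linarith : 0 ≤ 2 * R) (hdist x hx x' hx') (hdist y hy y' hy')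
      (hdist x' hx' y' hy')
    dsimp only
    linarith
  calc R ^ (sInf S - sSup S) ≤ R ^ (-(6 * M * R)) :=
        Real.rpow_le_rpow_of_exponent_ge hR (by linarith) (by linarith)
    _ ≤ Real.exp (6 * M) := rpow_neg_mul_self_le_exp (by linarith) hR
end
end

section
/- Let ω₀ : [1/e, ∞) → ℝ be non-increasing with ω₀(1/e) = 2 and lim_{r→∞} ω₀(r) > 1, and define ω : [0,∞) → ℝ by ω(0) = 3, ω(r) = 3 − min(−1/log r, 1) for 0 < r < 1/e, and ω(r) = ω₀(r) for r ≥ 1/e. Define p : ℝⁿ × ℝⁿ → ℝ by p(x,y) = ω(|x−y|). Then p satisfies (P2) in the unit ball B₁(0) ⊂ ℝⁿ: for every open ball B = B_R(x₀) whose closure is contained in B₁(0), one has p₊(B×Bᶜ) ≤ p₊(B×B) and p₋(B×Bᶜ) ≤ p₋(B×B), where Bᶜ = ℝⁿ∖B; in fact p₊(B×Bᶜ) ≤ 3 = p₊(B×B). -/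
open MeasureTheory Metric Set Filter
open scoped ENNReal Topology
noncomputable section

/-- The explicit modulus of continuity of Remark 1.3 (ii). -/
def omegaEx (ω₀ : ℝ → ℝ) (r : ℝ) : ℝ :=
  if r = 0 then 3
  else if r < (Real.exp 1)⁻¹ then 3 - min (-1 / Real.log r) 1
  else ω₀ r

lemma omegaEx_le_three {ω₀ : ℝ → ℝ} (hanti : AntitoneOn ω₀ (Set.Ici (Real.exp 1)⁻¹))
    (hval : ω₀ (Real.exp 1)⁻¹ = 2) {r : ℝ} (hr : 0 ≤ r) : omegaEx ω₀ r ≤ 3 := by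
  unfold omegaEx
  split_ifs with h0 h1
  · exact le_rfl
  · have hlog : Real.log r ≤ 0 :=
      Real.log_nonpos hr (h1.le.trans (inv_le_one_of_one_le₀ (Real.one_le_exp zero_le_one)))
    have : 0 ≤ min (-1 / Real.log r) 1 :=
      le_min (div_nonneg_of_nonpos (by norm_num) hlog) zero_le_one
    linarith
  · have := hanti Set.self_mem_Ici (not_lt.mp h1) (not_lt.mp h1)
    linarith

lemma omegaEx_antitoneOn {ω₀ : ℝ → ℝ} (hanti : AntitoneOn ω₀ (Set.Ici (Real.exp 1)⁻¹))
    (hval : ω₀ (Real.exp 1)⁻¹ = 2) : AntitoneOn (omegaEx ω₀) (Set.Ici 0) := by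
  intro r hr s hs hrs
  rcases (Set.mem_Ici.mp hr).eq_or_lt with rfl | hr0
  · exact (omegaEx_le_three hanti hval hs).trans_eq (by simp [omegaEx])
  have hs0 : 0 < s := hr0.trans_le hrs
  unfold omegaEx
  rw [if_neg hr0.ne', if_neg hs0.ne']
  split_ifs with h1 h2 h2
  · have hlog : Real.log s < 0 := Real.log_neg hs0
      (h1.trans_le (inv_le_one_of_one_le₀ (Real.one_le_exp zero_le_one)))
    have := one_div_le_one_div_of_neg_of_le hlog (Real.log_le_log hr0 hrs)
    gcongr 3 - min ?_ 1
    rw [neg_div, neg_div]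
    exact neg_le_neg this
  · exact absurd (hrs.trans_lt h1) h2
  · have := hanti Set.self_mem_Ici (not_lt.mp h1) (not_lt.mp h1)
    have := min_le_right (-1 / Real.log r) 1
    linarith
  · exact hanti (not_lt.mp h2) (not_lt.mp h1) hrs

lemma le_omegaEx {ω₀ : ℝ → ℝ} (hanti : AntitoneOn ω₀ (Set.Ici (Real.exp 1)⁻¹))
    (hval : ω₀ (Real.exp 1)⁻¹ = 2) {l : ℝ} (hl : Tendsto ω₀ atTop (𝓝 l)) {r : ℝ}
    (hr : 0 ≤ r) : l ≤ omegaEx ω₀ r := by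
  refine le_of_tendsto hl ?_
  filter_upwards [eventually_ge_atTop (max r (Real.exp 1)⁻¹)] with s hs
  have he : (Real.exp 1)⁻¹ ≤ s := (le_max_right _ _).trans hs
  have hs0 : 0 < s := (inv_pos.mpr (Real.exp_pos 1)).trans_le he
  have := omegaEx_antitoneOn hanti hval hr hs0.le ((le_max_left _ _).trans hs)
  rwa [omegaEx, if_neg hs0.ne', if_neg he.not_gt] at this

/-- the exponent `p(x,y) = ω(|x-y|)` satisfies (P2) in the unit ball. -/
theorem statement13 {n : ℕ} (hn : 1 ≤ n) (ω₀ : ℝ → ℝ)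
    (hanti : AntitoneOn ω₀ (Set.Ici (Real.exp 1)⁻¹))
    (hval : ω₀ (Real.exp 1)⁻¹ = 2)
    (hlim : ∃ l : ℝ, 1 < l ∧ Filter.Tendsto ω₀ Filter.atTop (nhds l)) :
    ∀ (x₀ : Rn n) (R : ℝ), 0 < R → closedBall x₀ R ⊆ ball (0 : Rn n) 1 →
      pSup (fun x y : Rn n => omegaEx ω₀ ‖x - y‖) (ball x₀ R) ((ball x₀ R)ᶜ)
          ≤ pSup (fun x y : Rn n => omegaEx ω₀ ‖x - y‖) (ball x₀ R) (ball x₀ R) ∧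
        pInf (fun x y : Rn n => omegaEx ω₀ ‖x - y‖) (ball x₀ R) ((ball x₀ R)ᶜ)
          ≤ pInf (fun x y : Rn n => omegaEx ω₀ ‖x - y‖) (ball x₀ R) (ball x₀ R) ∧
        pSup (fun x y : Rn n => omegaEx ω₀ ‖x - y‖) (ball x₀ R) ((ball x₀ R)ᶜ) ≤ 3 ∧
        pSup (fun x y : Rn n => omegaEx ω₀ ‖x - y‖) (ball x₀ R) (ball x₀ R) = 3 := by
  intro x₀ R hR _
  obtain ⟨l, _, hl⟩ := hlim
  have hle (F : Set (Rn n)) :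
      pSup (fun x y : Rn n => omegaEx ω₀ ‖x - y‖) (ball x₀ R) F ≤ 3 := by
    refine Real.sSup_le ?_ (by norm_num)
    rintro _ ⟨x, -, y, -, rfl⟩
    exact omegaEx_le_three hanti hval (norm_nonneg _)
  have heq : pSup (fun x y : Rn n => omegaEx ω₀ ‖x - y‖) (ball x₀ R) (ball x₀ R) = 3 := by
    refine (hle _).antisymm (le_csSup ⟨3, ?_⟩
      ⟨x₀, mem_ball_self hR, x₀, mem_ball_self hR, by simp [omegaEx]⟩)
    rintro _ ⟨x, -, y, -, rfl⟩
    exact omegaEx_le_three hanti hval (norm_nonneg _)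
  refine ⟨(hle _).trans_eq heq.symm, ?_, hle _, heq⟩
  refine le_csInf ⟨_, x₀, mem_ball_self hR, x₀, mem_ball_self hR, rfl⟩ ?_
  rintro _ ⟨x, hx, y, hy, rfl⟩
  set v : Rn n := EuclideanSpace.single ⟨0, hn⟩ (2 * R)
  have hv : ‖v‖ = 2 * R := by simp [v, abs_of_pos hR]
  refine le_trans (b := omegaEx ω₀ ‖x₀ - (x₀ + v)‖)
    (csInf_le ⟨l, ?_⟩ ⟨x₀, mem_ball_self hR, x₀ + v, ?_, rfl⟩)
    (omegaEx_antitoneOn hanti hval (norm_nonneg _) (norm_nonneg _) ?_)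
  · rintro _ ⟨x, -, y, -, rfl⟩
    exact le_omegaEx hanti hval hl (norm_nonneg _)
  · simp only [mem_compl_iff, mem_ball, dist_self_add_left, hv]
    linarith
  · rw [sub_add_cancel_left, norm_neg, hv, ← dist_eq_norm]
    have := dist_triangle_right x y x₀
    rw [mem_ball] at hx hy
    linarith
end
end
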